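/- arXiv:1704.05544 — 10 statements merged into one kernel-verified Lean document; each statement's English description precedes it below -/
import Mathlib

section
/- Let p be an odd prime with p ≡ 1 (mod 4) and n a positive integer. Then the number of elements x of R^{(p^n)} such that x - 1 ∈ D_1^{(p^n)} is 0, and the number of elements x of R^{(p^n)} such that x - 1 ∈ D_0^{(p^n)} is p^{n-1}; i.e., |R^{(p^n)} ∩ (D_1^{(p^n)} + 1)| = 0 and |R^{(p^n)} ∩ (D_0^{(p^n)} + 1)| = p^{n-1}. -/
/-- The Ding–Helleseth generalized cyclotomic class of order 2 in `ZMod N`: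
`DH N 0` is the set of square units, `DH N 1` the set of non-square units. -/
def DH (N : ℕ) (i : ℕ) : Set (ZMod N) :=
  {x | IsUnit x ∧ (IsSquare x ↔ i % 2 = 0)}

/-- `R^{(p^n)}`, the set of multiples of `p` in `ZMod (p^n)`,
i.e. `{0, p, 2p, ..., (p^(n-1)-1)p}`. -/
def Rset (p n : ℕ) : Set (ZMod (p ^ n)) :=
  {x | (p : ZMod (p ^ n)) ∣ x}

lemma pow_eq_of_dvd (p m : ℕ) (a b : ZMod (p ^ (m + 1))) (h : (p : ZMod (p ^ (m + 1))) ∣ a - b) :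
    a ^ (p ^ m) = b ^ (p ^ m) := by
  have h1 := dvd_sub_pow_of_dvd_sub h m
  have h0 : ((p : ZMod (p ^ (m + 1))) ^ (m + 1)) = 0 := by
    have := ZMod.natCast_self (p ^ (m + 1))
    push_cast at this
    exact this
  rw [h0, zero_dvd_iff] at h1
  exact sub_eq_zero.mp h1

lemma neg_one_isSq (p m : ℕ) (hp : p.Prime) (hodd : Odd p) (h4 : p % 4 = 1) :
    IsSquare (-1 : ZMod (p ^ (m + 1))) := by
  haveI : Fact p.Prime := ⟨hp⟩
  have h := (ZMod.exists_sq_eq_neg_one_iff (p := p)).mpr (by omega)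
  obtain ⟨c, hc⟩ := h
  obtain ⟨k, rfl⟩ := ZMod.natCast_zmod_surjective c
  have hd : p ∣ k * k + 1 := by
    rw [← ZMod.natCast_eq_zero_iff]
    push_cast
    rw [← hc]; ring
  obtain ⟨q, hq⟩ := hd
  have h2 : (p : ZMod (p ^ (m + 1))) ∣ (k : ZMod (p ^ (m + 1))) * k - (-1) := by
    refine ⟨(q : ZMod (p ^ (m + 1))), ?_⟩
    rw [sub_neg_eq_add]
    exact_mod_cast congrArg (Nat.cast : ℕ → ZMod (p ^ (m + 1))) hq
  have h3 := pow_eq_of_dvd p m _ _ h2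
  rw [(hodd.pow).neg_one_pow, mul_pow] at h3
  exact ⟨_, h3.symm⟩

lemma sub_one_good (p m : ℕ) (hp : p.Prime) (hodd : Odd p) (h4 : p % 4 = 1)
    (x : ZMod (p ^ (m + 1))) (hx : (p : ZMod (p ^ (m + 1))) ∣ x) :
    IsUnit (x - 1) ∧ IsSquare (x - 1) := by
  have h3 := pow_eq_of_dvd p m (x - 1) (-1) (by simpa using hx)
  rw [(hodd.pow).neg_one_pow] at h3
  constructor
  · have : IsUnit ((x - 1) ^ p ^ m) := by rw [h3]; exact isUnit_one.neg
    exact (isUnit_pow_iff (pow_ne_zero _ hp.ne_zero)).mp this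
  · have h5 : x - 1 = (-1) * (x - 1) ^ (p ^ m + 1) := by rw [pow_succ (x - 1), h3]; ring
    rw [h5]
    exact (neg_one_isSq p m hp hodd h4).mul ((hodd.pow.add_one).isSquare_pow _)

lemma Rset_ncard (p m : ℕ) (hp : p.Prime) : (Rset p (m + 1)).ncard = p ^ m := by
  have hpos := hp.pos
  haveI : NeZero (p ^ (m + 1)) := ⟨pow_ne_zero _ hp.ne_zero⟩
  have himg : Rset p (m + 1) =
      (fun k : ℕ => ((p * k : ℕ) : ZMod (p ^ (m + 1)))) '' (Finset.range (p ^ m) : Set ℕ) := by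
    ext x
    constructor
    · rintro ⟨y, rfl⟩
      refine ⟨y.val % p ^ m, by simpa using Nat.mod_lt _ (pow_pos hpos m), ?_⟩
      have : ((p * y.val : ℕ) : ZMod (p ^ (m + 1))) = p * y := by simp
      rw [← this]
      show ((p * (y.val % p ^ m) : ℕ) : ZMod (p ^ (m + 1))) = _
      rw [ZMod.natCast_eq_natCast_iff]
      generalize y.val = t
      rw [pow_succ']
      exact Nat.ModEq.mul_left' _ (Nat.mod_modEq _ _)
    · rintro ⟨k, -, rfl⟩
      exact ⟨(k : ZMod (p ^ (m + 1))), by push_cast; rfl⟩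
  rw [himg, Set.ncard_image_of_injOn, Set.ncard_coe_finset, Finset.card_range]
  intro a ha b hb hab
  simp only [Finset.coe_range, Set.mem_Iio] at ha hb
  have h := (ZMod.natCast_eq_natCast_iff _ _ _).mp hab
  rw [pow_succ'] at h
  have := Nat.ModEq.eq_of_lt_of_lt h (Nat.mul_lt_mul_of_pos_left ha hpos)
    (Nat.mul_lt_mul_of_pos_left hb hpos)
  exact Nat.eq_of_mul_eq_mul_left hpos this

theorem stmt_0 (p n : ℕ) (hp : p.Prime) (hodd : Odd p) (h4 : p % 4 = 1) (hn : 0 < n) :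
    (Rset p n ∩ ((· + 1) '' DH (p ^ n) 1)).ncard = 0 ∧
    (Rset p n ∩ ((· + 1) '' DH (p ^ n) 0)).ncard = p ^ (n - 1) := by
  obtain ⟨m, rfl⟩ : ∃ m, n = m + 1 := ⟨n - 1, by omega⟩
  constructor
  · have : Rset p (m + 1) ∩ ((· + 1) '' DH (p ^ (m + 1)) 1) = ∅ := by
      ext x
      simp only [Set.mem_empty_iff_false, iff_false]
      rintro ⟨hx, y, ⟨-, hy⟩, rfl⟩
      have := (sub_one_good p m hp hodd h4 _ hx).2
      simp only [add_sub_cancel_right] at this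
      have := hy.mp this
      omega
    rw [this, Set.ncard_empty]
  · have : Rset p (m + 1) ∩ ((· + 1) '' DH (p ^ (m + 1)) 0) = Rset p (m + 1) := by
      apply Set.inter_eq_left.mpr
      intro x hx
      obtain ⟨h1, h2⟩ := sub_one_good p m hp hodd h4 x hx
      exact ⟨x - 1, ⟨h1, by simp [h2]⟩, by simp⟩
    rw [this, Rset_ncard p m hp, Nat.add_sub_cancel]
end

section
/- Let p be an odd prime with p ≡ 3 (mod 4) and n a positive integer. Then the number of elements x of R^{(p^n)} such that x - 1 ∈ D_1^{(p^n)} is p^{n-1}, and the number of elements x of R^{(p^n)} such that x - 1 ∈ D_0^{(p^n)} is 0; i.e., |R^{(p^n)} ∩ (D_1^{(p^n)} + 1)| = p^{n-1} and |R^{(p^n)} ∩ (D_0^{(p^n)} + 1)| = 0. -/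
theorem Rset_nonsq (p n : ℕ) (hp : p.Prime) (h4 : p % 4 = 3) (hn : 0 < n)
    (y : ZMod (p ^ n)) (hy : y + 1 ∈ Rset p n) : ¬ IsSquare y := by
  have : Fact p.Prime := ⟨hp⟩
  rintro ⟨z, hz⟩
  obtain ⟨k, hk⟩ := hy
  let f := ZMod.castHom (dvd_pow_self p hn.ne') (ZMod p)
  have h1 : f y + 1 = 0 := by
    have := congrArg f hk
    rw [map_add, map_mul, map_one, map_natCast, ZMod.natCast_self, zero_mul] at this
    exact this
  have h2 : IsSquare (-1 : ZMod p) :=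
    ⟨f z, by rw [← map_mul, ← hz]; exact (eq_neg_of_add_eq_zero_left h1).symm⟩
  exact ZMod.exists_sq_eq_neg_one_iff.mp h2 h4

theorem Rset_unit (p n : ℕ) (y : ZMod (p ^ n)) (hy : y + 1 ∈ Rset p n) : IsUnit y := by
  obtain ⟨k, hk⟩ := hy
  have hnil : IsNilpotent (y + 1) := by
    refine ⟨n, ?_⟩
    rw [hk, mul_pow, ← Nat.cast_pow, ZMod.natCast_self, zero_mul]
  simpa using hnil.isUnit_sub_one

theorem Rset_card (p n : ℕ) (hp : p.Prime) (hn : 0 < n) :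
    (Rset p n).ncard = p ^ (n - 1) := by
  obtain ⟨m, rfl⟩ : ∃ m, n = m + 1 := ⟨n - 1, by omega⟩
  have : NeZero (p ^ (m + 1)) := ⟨pow_ne_zero _ hp.ne_zero⟩
  have himg : Rset p (m + 1) =
      (fun k : ℕ => ((p * k : ℕ) : ZMod (p ^ (m + 1)))) '' (Finset.range (p ^ m) : Set ℕ) := by
    ext x
    constructor
    · rintro ⟨k, rfl⟩
      refine ⟨k.val % p ^ m, ?_, ?_⟩
      · simpa using Nat.mod_lt _ (pow_pos hp.pos m)
      · have : ((p * (k.val % p ^ m) : ℕ) : ZMod (p ^ (m + 1))) = ((p * k.val : ℕ) : _) := by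
          rw [ZMod.natCast_eq_natCast_iff]
          generalize k.val = j
          rw [pow_succ']
          exact (Nat.mod_modEq _ _).mul_left' p
        simp only [this]
        rw [Nat.cast_mul, ZMod.natCast_zmod_val]
    · rintro ⟨k, -, rfl⟩
      exact ⟨k, by push_cast; rfl⟩
  rw [himg, Set.InjOn.ncard_image, Set.ncard_coe_finset, Finset.card_range]
  · simp
  · intro a ha b hb hab
    simp only [Finset.coe_range, Set.mem_Iio] at ha hb
    simp only [ZMod.natCast_eq_natCast_iff, pow_succ'] at hab
    exact (Nat.ModEq.mul_left_cancel' hp.ne_zero hab).eq_of_lt_of_lt ha hb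

theorem stmt_1 (p n : ℕ) (hp : p.Prime) (hodd : Odd p) (h4 : p % 4 = 3) (hn : 0 < n) :
    (Rset p n ∩ ((· + 1) '' DH (p ^ n) 1)).ncard = p ^ (n - 1) ∧
    (Rset p n ∩ ((· + 1) '' DH (p ^ n) 0)).ncard = 0 := by
  constructor
  · rw [← Rset_card p n hp hn]
    congr 1
    refine Set.inter_eq_left.mpr fun x hx => ?_
    have hx' : (x - 1) + 1 ∈ Rset p n := by simpa using hx
    refine ⟨x - 1, ⟨Rset_unit p n _ hx', ?_⟩, by simp⟩
    simpa using Rset_nonsq p n hp h4 hn _ hx'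
  · have : Rset p n ∩ ((· + 1) '' DH (p ^ n) 0) = ∅ := by
      refine Set.eq_empty_iff_forall_notMem.mpr ?_
      rintro x ⟨hx, y, ⟨-, hy⟩, rfl⟩
      exact Rset_nonsq p n hp h4 hn y hx (hy.mpr rfl)
    rw [this, Set.ncard_empty]
end

section
/- Let p be an odd prime with p ≡ 3 (mod 4) and n a positive integer. Then the generalized cyclotomic numbers of order 2 modulo p^n satisfy (1,0)^{(p^n)} = (0,0)^{(p^n)} = (1,1)^{(p^n)} = p^{n-1}(p-3)/4 and (0,1)^{(p^n)} = p^{n-1}(p+1)/4. -/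
/-- The generalized cyclotomic number `(i,j)^{(N)} = |(D_i + 1) ∩ D_j|`. -/
noncomputable def cycNum (N : ℕ) (i j : ℕ) : ℕ :=
  (((· + 1) '' DH N i) ∩ DH N j).ncard


section Aux

variable {p : ℕ} [hpf : Fact p.Prime]

/-- Reduction modulo `p`. -/
noncomputable def redHom (p n : ℕ) (hn : 0 < n) : ZMod (p ^ n) →+* ZMod p :=
  ZMod.castHom (dvd_pow_self p hn.ne') (ZMod p)

lemma red_unit (n : ℕ) (hn : 0 < n) (x : ZMod (p ^ n)) :
    IsUnit x ↔ redHom p n hn x ≠ 0 := by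
  haveI : NeZero (p ^ n) := ⟨pow_ne_zero _ hpf.out.ne_zero⟩
  obtain ⟨a, rfl⟩ := ZMod.natCast_zmod_surjective x
  rw [ZMod.isUnit_iff_coprime, map_natCast, Ne, ZMod.natCast_eq_zero_iff,
    Nat.coprime_pow_right_iff hn, Nat.coprime_comm, hpf.out.coprime_iff_not_dvd]

lemma red_one_pow (n : ℕ) (hn : 0 < n) (u : ZMod (p ^ n)) (hu : redHom p n hn u = 1) :
    u ^ p ^ (n - 1) = 1 := by
  obtain ⟨a, rfl⟩ := ZMod.intCast_surjective u
  rw [map_intCast] at hu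
  have h1 : (p : ℤ) ∣ a - 1 := by
    rw [← ZMod.intCast_zmod_eq_zero_iff_dvd]
    push_cast
    rw [hu, sub_self]
  have h2 := dvd_sub_pow_of_dvd_sub (R := ℤ) (p := p) h1 (n - 1)
  rw [Nat.sub_add_cancel hn, one_pow] at h2
  have h3 : ((a ^ p ^ (n - 1) - 1 : ℤ) : ZMod (p ^ n)) = 0 := by
    rw [ZMod.intCast_zmod_eq_zero_iff_dvd]
    exact_mod_cast h2
  push_cast at h3
  exact sub_eq_zero.mp h3

lemma red_square (hodd : Odd p) (n : ℕ) (hn : 0 < n) (x : ZMod (p ^ n)) (hx : IsUnit x) :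
    IsSquare x ↔ IsSquare (redHom p n hn x) := by
  constructor
  · exact fun h => h.map _
  · rintro ⟨y, hy⟩
    obtain ⟨z, rfl⟩ := ZMod.castHom_surjective (dvd_pow_self p hn.ne') y
    change redHom p n hn x = redHom p n hn z * redHom p n hn z at hy
    have hz : IsUnit z := by
      rw [red_unit n hn]
      intro h0
      rw [h0, mul_zero] at hy
      exact (red_unit n hn x).1 hx hy
    obtain ⟨v, rfl⟩ := hz
    set w : ZMod (p ^ n) := ((v⁻¹ : (ZMod (p ^ n))ˣ) : ZMod (p ^ n)) with hw
    have hvw : (v : ZMod (p ^ n)) * w = 1 := v.mul_inv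
    have hr : redHom p n hn v * redHom p n hn w = 1 := by rw [← map_mul, hvw, map_one]
    have h1 : redHom p n hn (x * w * w) = 1 := by
      rw [map_mul, map_mul, hy]
      linear_combination (redHom p n hn v * redHom p n hn w + 1) * hr
    have h2 := red_one_pow n hn _ h1
    obtain ⟨k, hk⟩ := hodd.pow (n := n - 1)
    rw [hk] at h2
    have h3 : x * w * w = ((x * w * w) ^ (k + 1)) * ((x * w * w) ^ (k + 1)) := by
      calc x * w * w = (x * w * w) ^ (2 * k + 1) * (x * w * w) := by rw [h2, one_mul]
        _ = _ := by ring
    refine ⟨v * (x * w * w) ^ (k + 1), ?_⟩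
    linear_combination (v : ZMod (p ^ n)) * v * h3 - (x * (v * w + 1)) * hvw

/-- sign of a class -/
def sg (i : ℕ) : ℤ := if i % 2 = 0 then 1 else -1

lemma mem_DH (hodd : Odd p) (n : ℕ) (hn : 0 < n) (i : ℕ) (x : ZMod (p ^ n)) :
    x ∈ DH (p ^ n) i ↔ quadraticChar (ZMod p) (redHom p n hn x) = sg i := by
  have h2 : ringChar (ZMod p) ≠ 2 := by
    rw [ZMod.ringChar_zmod_n]; rintro rfl; exact absurd hodd (by decide)
  unfold DH sg
  rw [Set.mem_setOf_eq]
  by_cases hx : IsUnit x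
  · have h0 := (red_unit n hn x).1 hx
    rw [red_square hodd n hn x hx, ← quadraticChar_one_iff_isSquare h0]
    rcases quadraticChar_dichotomy h0 with h | h <;> split_ifs with hi <;> simp [hx, h, hi]
  · have h0 : redHom p n hn x = 0 := by
      by_contra h; exact hx ((red_unit n hn x).2 h)
    rw [h0]
    split_ifs <;> simp [hx]

/-- the count modulo `p` -/
noncomputable def cnt (p : ℕ) [Fact p.Prime] (a b : ℤ) : ℕ :=
  (Finset.univ.filter fun x : ZMod p =>
    quadraticChar (ZMod p) x = a ∧ quadraticChar (ZMod p) (x + 1) = b).card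

lemma card_fiber (n : ℕ) (hn : 0 < n) [NeZero (p ^ n)] (y : ZMod p) :
    (Finset.univ.filter fun x : ZMod (p ^ n) => redHom p n hn x = y).card = p ^ (n - 1) := by
  have hs : Function.Surjective (redHom p n hn) :=
    ZMod.castHom_surjective (dvd_pow_self p hn.ne')
  have key : ∀ y z : ZMod p,
      (Finset.univ.filter fun x : ZMod (p ^ n) => redHom p n hn x = y).card =
      (Finset.univ.filter fun x : ZMod (p ^ n) => redHom p n hn x = z).card := by
    intro y z
    obtain ⟨t, ht⟩ := hs (z - y)
    refine Finset.card_bij' (fun x _ => x + t) (fun x _ => x - t) ?_ ?_ ?_ ?_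
    · intro x; simp [ht]; intro h; rw [h]; ring
    · intro x; simp [ht]; intro h; rw [h]; ring
    · simp
    · simp
  have hsum := Finset.card_eq_sum_card_fiberwise (f := redHom p n hn) (s := Finset.univ)
    (t := Finset.univ) (by simp)
  rw [Finset.sum_congr rfl (fun z _ => key z y)] at hsum
  simp only [Finset.card_univ, ZMod.card, Finset.sum_const, smul_eq_mul] at hsum
  obtain ⟨m, rfl⟩ : ∃ m, n = m + 1 := ⟨n - 1, by omega⟩
  simp only [pow_succ', Nat.add_sub_cancel] at hsum ⊢
  exact (Nat.eq_of_mul_eq_mul_left hpf.out.pos hsum).symm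

lemma cyc_eq (hodd : Odd p) (n : ℕ) (hn : 0 < n) (i j : ℕ) :
    cycNum (p ^ n) i j = p ^ (n - 1) * cnt p (sg i) (sg j) := by
  haveI : NeZero (p ^ n) := ⟨pow_ne_zero _ hpf.out.ne_zero⟩
  have h1 : ((· + 1) '' DH (p ^ n) i) ∩ DH (p ^ n) j =
      (· + 1) '' ((Finset.univ.filter fun x : ZMod (p ^ n) => redHom p n hn x ∈
        (Finset.univ.filter fun x : ZMod p =>
    quadraticChar (ZMod p) x = sg i ∧ quadraticChar (ZMod p) (x + 1) = sg j) :
        Finset (ZMod (p ^ n))) : Set (ZMod (p ^ n))) := by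
    ext y
    constructor
    · rintro ⟨⟨x, hx, rfl⟩, hy⟩
      refine ⟨x, ?_, rfl⟩
      rw [mem_DH hodd n hn] at hx hy
      rw [map_add, map_one] at hy
      simpa using And.intro hx hy
    · rintro ⟨x, hx, rfl⟩
      simp only [Finset.coe_filter, Finset.mem_filter, Finset.mem_univ, true_and,
        Set.mem_setOf_eq] at hx
      refine ⟨⟨x, (mem_DH hodd n hn _ _).2 hx.1, rfl⟩, (mem_DH hodd n hn _ _).2 ?_⟩
      simpa using hx.2
  unfold cycNum cnt
  rw [h1, Set.ncard_image_of_injective _ (add_left_injective 1), Set.ncard_coe_finset]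
  rw [Finset.card_eq_sum_card_fiberwise (f := redHom p n hn)
    (t := (Finset.univ.filter fun x : ZMod p =>
    quadraticChar (ZMod p) x = sg i ∧ quadraticChar (ZMod p) (x + 1) = sg j))
    (by intro x hx; simpa using hx)]
  rw [Finset.sum_congr rfl (g := fun _ => p ^ (n - 1))]
  · rw [Finset.sum_const, smul_eq_mul, mul_comm]
  · intro y hy
    rw [← card_fiber n hn y, Finset.filter_filter]
    congr 1
    ext x
    simp only [Finset.mem_filter, Finset.mem_univ, true_and] at hy ⊢
    constructor
    · exact fun h => h.2
    · rintro rfl; exact ⟨hy, rfl⟩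

lemma chi_neg (h4 : p % 4 = 3) (x : ZMod p) :
    quadraticChar (ZMod p) (-x) = - quadraticChar (ZMod p) x := by
  have h : quadraticChar (ZMod p) (-1) = -1 := by
    rw [quadraticChar_neg_one_iff_not_isSquare, ZMod.exists_sq_eq_neg_one_iff]
    simpa using h4
  rw [neg_eq_neg_one_mul, map_mul, h, neg_one_mul]

lemma cnt_00_11 (h4 : p % 4 = 3) : cnt p 1 1 = cnt p (-1) (-1) := by
  unfold cnt
  refine Finset.card_bij' (fun x _ => -(x + 1)) (fun x _ => -(x + 1)) ?_ ?_ ?_ ?_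
  · intro x
    have : -(x + 1) + 1 = -x := by ring
    simp only [Finset.mem_filter, Finset.mem_univ, true_and, this, chi_neg h4]
    rintro ⟨h, h'⟩; simp [h, h']
  · intro x
    have : -(x + 1) + 1 = -x := by ring
    simp only [Finset.mem_filter, Finset.mem_univ, true_and, this, chi_neg h4]
    rintro ⟨h, h'⟩; simp [h, h']
  · intro x _; ring
  · intro x _; ring

lemma chi_inv (x : ZMod p) (hx : quadraticChar (ZMod p) x = -1) :
    x ≠ 0 ∧ quadraticChar (ZMod p) x⁻¹ = -1 := by
  have h0 : x ≠ 0 := by rintro rfl; simp at hx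
  refine ⟨h0, ?_⟩
  have : quadraticChar (ZMod p) (x * x⁻¹) = 1 := by rw [mul_inv_cancel₀ h0, map_one]
  rw [map_mul, hx] at this
  linarith

lemma cnt_10_11 : cnt p (-1) 1 = cnt p (-1) (-1) := by
  unfold cnt
  refine Finset.card_bij' (fun x _ => x⁻¹) (fun x _ => x⁻¹) ?_ ?_ ?_ ?_
  · intro x
    simp only [Finset.mem_filter, Finset.mem_univ, true_and]
    rintro ⟨h, h'⟩
    obtain ⟨h0, hi⟩ := chi_inv x h
    have : x⁻¹ + 1 = x⁻¹ * (x + 1) := by field_simp; ring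
    rw [this, map_mul, hi, h']; simp
  · intro x
    simp only [Finset.mem_filter, Finset.mem_univ, true_and]
    rintro ⟨h, h'⟩
    obtain ⟨h0, hi⟩ := chi_inv x h
    have : x⁻¹ + 1 = x⁻¹ * (x + 1) := by field_simp; ring
    rw [this, map_mul, hi, h']; simp
  · intro x _; exact inv_inv x
  · intro x _; exact inv_inv x

/-- size of a class modulo `p` -/
noncomputable def cls (p : ℕ) [Fact p.Prime] (a : ℤ) : ℕ :=
  (Finset.univ.filter fun x : ZMod p => quadraticChar (ZMod p) x = a).card

lemma cls_eq (h4 : p % 4 = 3) : cls p 1 = cls p (-1) := by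
  unfold cls
  refine Finset.card_bij' (fun x _ => -x) (fun x _ => -x) ?_ ?_ ?_ ?_
  · intro x; simp only [Finset.mem_filter, Finset.mem_univ, true_and, chi_neg h4]
    intro h; simp [h]
  · intro x; simp only [Finset.mem_filter, Finset.mem_univ, true_and, chi_neg h4]
    intro h; simp [h]
  · intro x _; exact neg_neg x
  · intro x _; exact neg_neg x

lemma chi_cases (x : ZMod p) : quadraticChar (ZMod p) x = 1 ∨ quadraticChar (ZMod p) x = -1 ∨
    (quadraticChar (ZMod p) x = 0 ∧ x = 0) := by
  by_cases h : x = 0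
  · right; right; simp [h]
  · rcases quadraticChar_dichotomy h with h | h <;> simp [h]

lemma cls_sum : cls p 1 + cls p (-1) + 1 = p := by
  have h : (Finset.univ : Finset (ZMod p)).card = p := by simp [ZMod.card]
  conv_rhs => rw [← h]
  have h0 : ({0} : Finset (ZMod p)).card = 1 := rfl
  unfold cls
  rw [← h0, ← Finset.card_union_of_disjoint, ← Finset.card_union_of_disjoint]
  · congr 1
    ext x
    simp only [Finset.mem_union, Finset.mem_filter, Finset.mem_univ, true_and,
      Finset.mem_singleton, iff_true]
    rcases chi_cases x with h | h | ⟨_, h⟩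
    · exact Or.inl (Or.inl h)
    · exact Or.inl (Or.inr h)
    · exact Or.inr h
  · rw [Finset.disjoint_left]; intro x; simp; rintro h rfl; simp at h
  · rw [Finset.disjoint_left]; intro x; simp; intro h; simp [h]

lemma cnt_sum (a : ℤ) : cnt p a 1 + cnt p a (-1) +
    (if quadraticChar (ZMod p) (-1) = a then 1 else 0) = cls p a := by
  have h0 : (Finset.univ.filter fun x : ZMod p => x = -1 ∧ quadraticChar (ZMod p) x = a).card
      = (if quadraticChar (ZMod p) (-1) = a then 1 else 0) := by
    split_ifs with h
    · rw [Finset.card_eq_one]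
      refine ⟨-1, ?_⟩
      ext x; simp; rintro rfl; exact h
    · rw [Finset.card_eq_zero]
      ext x; simp; rintro rfl; exact h
  rw [← h0]
  unfold cnt cls
  rw [← Finset.card_union_of_disjoint, ← Finset.card_union_of_disjoint]
  · congr 1
    ext x
    rcases chi_cases (x + 1) with h | h | ⟨_, h⟩
    · simp [h]; tauto
    · simp [h]; tauto
    · have := eq_neg_of_add_eq_zero_left h
      subst this
      simp
  · rw [Finset.disjoint_left]; intro x hx; simp at hx ⊢
    rintro rfl; simp at hx
  · rw [Finset.disjoint_left]; intro x; simp; intro _ h; simp [h]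

end Aux

theorem stmt_2 (p n : ℕ) (hp : p.Prime) (hodd : Odd p) (h4 : p % 4 = 3) (hn : 0 < n) :
    cycNum (p ^ n) 1 0 = p ^ (n - 1) * (p - 3) / 4 ∧
    cycNum (p ^ n) 0 0 = p ^ (n - 1) * (p - 3) / 4 ∧
    cycNum (p ^ n) 1 1 = p ^ (n - 1) * (p - 3) / 4 ∧
    cycNum (p ^ n) 0 1 = p ^ (n - 1) * (p + 1) / 4 := by
  haveI : Fact p.Prime := ⟨hp⟩
  have hm : quadraticChar (ZMod p) (-1) = -1 := by rw [chi_neg h4, map_one]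
  have e1 := cnt_00_11 h4
  have e2 := cnt_10_11 (p := p)
  have e3 := cls_eq h4
  have e4 := cls_sum (p := p)
  have e5 := cnt_sum (p := p) 1
  have e6 := cnt_sum (p := p) (-1)
  rw [hm] at e5 e6
  norm_num at e5 e6
  have s0 : sg 0 = 1 := rfl
  have s1 : sg 1 = -1 := rfl
  simp only [cyc_eq hodd n hn, s0, s1]
  have f1 : p - 3 = 4 * cnt p (-1) (-1) := by omega
  have f2 : p + 1 = 4 * cnt p 1 (-1) := by omega
  have g : ∀ a b : ℕ, a * (4 * b) / 4 = a * b := by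
    intro a b
    rw [mul_left_comm]; simp
  rw [f1, f2, g, g, e1, e2]
  simp
end

section
/- Let p be an odd prime with p ≡ 1 (mod 4) and n a positive integer. Then the generalized cyclotomic numbers of order 2 modulo p^n satisfy (0,1)^{(p^n)} = (1,0)^{(p^n)} = (1,1)^{(p^n)} = p^{n-1}(p-1)/4 and (0,0)^{(p^n)} = p^{n-1}(p-5)/4. -/
theorem aux_count (p : ℕ) [Fact p.Prime] (hp2 : p ≠ 2) (h4 : p % 4 = 1) (ε δ : ℤ)
    (hε : ε = 1 ∨ ε = -1) (hδ : δ = 1 ∨ δ = -1) :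
    4 * ((Finset.univ.filter (fun x : ZMod p =>
      quadraticChar (ZMod p) x = ε ∧ quadraticChar (ZMod p) (x + 1) = δ)).card : ℤ)
      = p - ε * δ - 2 - ε - δ := by
  classical
  have hchar : ringChar (ZMod p) ≠ 2 := by rw [ZMod.ringChar_zmod_n]; exact hp2
  set χ := quadraticChar (ZMod p) with hχ
  have hm1 : χ (-1) = 1 := by
    rw [hχ, quadraticChar_one_iff_isSquare (by simp), ZMod.exists_sq_eq_neg_one_iff]
    omega
  have hz : χ 0 = 0 := by rw [hχ]; exact quadraticChar_zero
  have hs : ∑ x, χ x = 0 := quadraticChar_sum_zero hchar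
  have hs1 : ∑ x, χ (x + 1) = 0 := by
    rw [← hs]; exact Equiv.sum_comp (Equiv.addRight (1 : ZMod p)) (fun x => χ x)
  have hj : ∑ x, χ x * χ (x + 1) = -1 := by
    have h := jacobiSum_nontrivial_inv (quadraticChar_ne_one hchar)
    rw [← hχ, (quadraticChar_isQuadratic (ZMod p)).inv, hm1, jacobiSum] at h
    rw [← h, ← Equiv.sum_comp (Equiv.neg (ZMod p))]
    refine Finset.sum_congr rfl fun x _ => ?_
    simp only [Equiv.neg_apply]
    rw [neg_eq_neg_one_mul x, map_mul, hm1, one_mul]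
    congr 2
    ring
  have hpt : ∀ x : ZMod p, (4 : ℤ) * (if χ x = ε ∧ χ (x + 1) = δ then 1 else 0)
      = 1 + ε * χ x + δ * χ (x + 1) + ε * δ * (χ x * χ (x + 1))
        - (if x = 0 then 1 + δ else 0) - (if x = -1 then 1 + ε else 0) := by
    intro x
    by_cases h0 : x = 0
    · subst h0
      have : (0 : ZMod p) ≠ -1 := by simp
      rcases hε with rfl | rfl <;> rcases hδ with rfl | rfl <;> simp [hz]
    by_cases h1 : x = -1
    · subst h1
      rcases hε with rfl | rfl <;> rcases hδ with rfl | rfl <;> simp [hm1, hz]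
    have h1' : x + 1 ≠ 0 := fun h => h1 (eq_neg_of_add_eq_zero_left h)
    rw [if_neg h0, if_neg h1]
    rcases quadraticChar_dichotomy h0 with ha | ha <;>
    rcases quadraticChar_dichotomy h1' with hb | hb <;>
    rw [← hχ] at ha hb <;> rw [ha, hb] <;>
    rcases hε with rfl | rfl <;> rcases hδ with rfl | rfl <;> norm_num
  rw [Finset.card_filter]
  push_cast
  rw [Finset.mul_sum, Finset.sum_congr rfl (fun x _ => hpt x)]
  simp only [Finset.sum_sub_distrib, Finset.sum_add_distrib, ← Finset.mul_sum, hs, hs1, hj,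
    Finset.sum_ite_eq', Finset.mem_univ, if_true]
  simp [ZMod.card]
  ring

theorem aux_unit (p n : ℕ) (hp : p.Prime) (hn : 0 < n) (f : ZMod (p ^ n) →+* ZMod p)
    (x : ZMod (p ^ n)) : IsUnit x ↔ f x ≠ 0 := by
  have : Fact p.Prime := ⟨hp⟩
  have : NeZero (p ^ n) := ⟨pow_ne_zero _ hp.ne_zero⟩
  obtain ⟨k, rfl⟩ := ZMod.natCast_zmod_surjective x
  rw [ZMod.isUnit_iff_coprime, map_natCast, Ne, ZMod.natCast_eq_zero_iff,
    Nat.coprime_pow_right_iff hn, Nat.coprime_comm, hp.coprime_iff_not_dvd]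

theorem aux_sq (p n : ℕ) (hp : p.Prime) (hodd : Odd p) (hn : 0 < n) (f : ZMod (p ^ n) →+* ZMod p)
    (x : ZMod (p ^ n)) (hx : IsUnit x) : IsSquare x ↔ IsSquare (f x) := by
  have : Fact p.Prime := ⟨hp⟩
  have : NeZero (p ^ n) := ⟨pow_ne_zero _ hp.ne_zero⟩
  refine ⟨fun h => h.map f, ?_⟩
  rintro ⟨y, hy⟩
  obtain ⟨z, rfl⟩ := ZMod.ringHom_surjective f y
  have hd : (p : ZMod (p ^ n)) ∣ x - z * z := by
    have h0 : f (x - z * z) = 0 := by rw [map_sub, map_mul, hy, sub_self]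
    obtain ⟨k, hk⟩ := ZMod.natCast_zmod_surjective (x - z * z)
    rw [← hk] at h0 ⊢
    rw [map_natCast, ZMod.natCast_eq_zero_iff] at h0
    exact Nat.cast_dvd_cast h0
  have h := dvd_sub_pow_of_dvd_sub hd (n - 1)
  rw [Nat.sub_add_cancel hn, ← Nat.cast_pow, ZMod.natCast_self, zero_dvd_iff, sub_eq_zero] at h
  obtain ⟨m, hm⟩ := hodd.pow (n := n - 1)
  obtain ⟨u, rfl⟩ := hx
  refine ⟨z ^ (p ^ (n - 1)) * ((u⁻¹ ^ m : (ZMod (p ^ n))ˣ) : ZMod (p ^ n)), ?_⟩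
  have h2 : z ^ (p ^ (n - 1)) * z ^ (p ^ (n - 1)) = ((u ^ (2 * m + 1) : (ZMod (p ^ n))ˣ) : ZMod (p ^ n)) := by
    rw [← mul_pow, ← h, Units.val_pow_eq_pow_val, hm]
  rw [mul_mul_mul_comm, h2, ← Units.val_mul, ← Units.val_mul]
  congr 1
  rw [inv_pow]
  group

theorem aux_fiber (p n : ℕ) (hp : p.Prime) (hn : 0 < n) (f : ZMod (p ^ n) →+* ZMod p)
    (T : Finset (ZMod p)) : (f ⁻¹' (T : Set (ZMod p))).ncard = p ^ (n - 1) * T.card := by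
  classical
  have : Fact p.Prime := ⟨hp⟩
  have : NeZero (p ^ n) := ⟨pow_ne_zero _ hp.ne_zero⟩
  have hf := ZMod.ringHom_surjective f
  set c := (Finset.univ.filter (fun x => f x = 0)).card with hc
  have hfib : ∀ y, (Finset.univ.filter (fun x => f x = y)).card = c := by
    intro y
    obtain ⟨z, rfl⟩ := hf y
    rw [hc]
    refine Finset.card_bij (fun x _ => x - z) ?_ ?_ ?_
    · intro x hx; simp at hx ⊢; rw [hx, sub_self]
    · intro a _ b _ h; exact sub_left_injective h
    · intro b hb
      refine ⟨b + z, ?_, by simp⟩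
      simp at hb ⊢; exact hb
  have key : ∀ S : Finset (ZMod p), (Finset.univ.filter (fun x => f x ∈ S)).card = S.card * c := by
    intro S
    rw [Finset.card_eq_sum_card_fiberwise (f := f) (t := S) (by intro x; simp)]
    rw [Finset.sum_const_nat (m := c)]
    intro y hy
    rw [← hfib y, Finset.filter_filter]
    congr 1
    ext x
    simp only [Finset.mem_filter, Finset.mem_univ, true_and]
    exact ⟨fun h => h.2, fun h => ⟨h ▸ hy, h⟩⟩
  have hcv : c = p ^ (n - 1) := by
    have := key Finset.univ
    simp [ZMod.card] at this
    obtain ⟨m, rfl⟩ : ∃ m, n = m + 1 := ⟨n - 1, by omega⟩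
    rw [pow_succ'] at this
    exact (Nat.eq_of_mul_eq_mul_left hp.pos this).symm
  rw [← hcv, mul_comm, ← key T, ← Set.ncard_coe_finset]
  congr 1
  ext x
  simp

theorem aux_mem (p n : ℕ) [Fact p.Prime] (hodd : Odd p) (hn : 0 < n)
    (f : ZMod (p ^ n) →+* ZMod p) (i : ℕ) (x : ZMod (p ^ n)) :
    x ∈ DH (p ^ n) i ↔ quadraticChar (ZMod p) (f x) = if i % 2 = 0 then 1 else -1 := by
  have hp : p.Prime := Fact.out
  unfold DH
  rw [Set.mem_setOf_eq]
  by_cases hu : IsUnit x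
  · have h0 := (aux_unit p n hp hn f x).1 hu
    rw [aux_sq p n hp hodd hn f x hu, ← quadraticChar_one_iff_isSquare h0]
    rcases quadraticChar_dichotomy h0 with h | h <;> rw [h] <;> split_ifs <;> simp_all
  · have h0 : f x = 0 := by
      by_contra h; exact hu ((aux_unit p n hp hn f x).2 h)
    rw [h0]
    simp only [hu, false_and, false_iff]
    split_ifs <;> simp

theorem aux_main (p n : ℕ) (hp : p.Prime) (hodd : Odd p) (h4 : p % 4 = 1) (hn : 0 < n)
    (i j : ℕ) (ε δ : ℤ) (hε : ε = if i % 2 = 0 then 1 else -1)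
    (hδ : δ = if j % 2 = 0 then 1 else -1) (k : ℕ) (hk : (4 * k : ℤ) = p - ε * δ - 2 - ε - δ) :
    cycNum (p ^ n) i j = p ^ (n - 1) * k := by
  have : Fact p.Prime := ⟨hp⟩
  have hp2 : p ≠ 2 := by rintro rfl; omega
  let f : ZMod (p ^ n) →+* ZMod p := ZMod.castHom (dvd_pow_self p hn.ne') (ZMod p)
  have hc := aux_count p hp2 h4 ε δ (by rw [hε]; split_ifs <;> simp) (by rw [hδ]; split_ifs <;> simp)
  have hT := aux_fiber p n hp hn f (Finset.univ.filter (fun x : ZMod p =>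
      quadraticChar (ZMod p) x = ε ∧ quadraticChar (ZMod p) (x + 1) = δ))
  have hkc : k = (Finset.univ.filter (fun x : ZMod p =>
      quadraticChar (ZMod p) x = ε ∧ quadraticChar (ZMod p) (x + 1) = δ)).card := by omega
  rw [hkc, ← hT, cycNum, ← Set.ncard_image_of_injective (f ⁻¹' _) (add_left_injective (1 : ZMod (p ^ n)))]
  congr 1
  ext y
  simp only [Set.mem_inter_iff, Set.mem_image, Set.mem_preimage, Finset.mem_coe,
    Finset.mem_filter, Finset.mem_univ, true_and]
  constructor
  · rintro ⟨⟨x, hx, rfl⟩, hy⟩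
    rw [aux_mem p n hodd hn f] at hx hy
    rw [map_add, map_one] at hy
    exact ⟨x, ⟨by rw [hx, hε], by rw [hy, hδ]⟩, rfl⟩
  · rintro ⟨x, ⟨h1, h2⟩, rfl⟩
    refine ⟨⟨x, ?_, rfl⟩, ?_⟩
    · rw [aux_mem p n hodd hn f, h1, hε]
    · rw [aux_mem p n hodd hn f, map_add, map_one, h2, hδ]

theorem stmt_3 (p n : ℕ) (hp : p.Prime) (hodd : Odd p) (h4 : p % 4 = 1) (hn : 0 < n) :
    cycNum (p ^ n) 0 1 = p ^ (n - 1) * (p - 1) / 4 ∧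
    cycNum (p ^ n) 1 0 = p ^ (n - 1) * (p - 1) / 4 ∧
    cycNum (p ^ n) 1 1 = p ^ (n - 1) * (p - 1) / 4 ∧
    cycNum (p ^ n) 0 0 = p ^ (n - 1) * (p - 5) / 4 := by
  have h2 := hp.two_le
  have d1 : 4 ∣ p - 1 := by omega
  have d5 : 4 ∣ p - 5 := by omega
  rw [Nat.mul_div_assoc _ d1, Nat.mul_div_assoc _ d5]
  refine ⟨?_, ?_, ?_, ?_⟩
  · exact aux_main p n hp hodd h4 hn 0 1 1 (-1) (by simp) (by simp) _ (by omega)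
  · exact aux_main p n hp hodd h4 hn 1 0 (-1) 1 (by simp) (by simp) _ (by omega)
  · exact aux_main p n hp hodd h4 hn 1 1 (-1) (-1) (by simp) (by simp) _ (by omega)
  · exact aux_main p n hp hodd h4 hn 0 0 1 1 (by simp) (by simp) _ (by omega)
end

section
/- Let p be an odd prime, n a positive integer, and let r ∈ R^{(p^n)} (i.e., r is a multiple of p in Z/p^nZ). Then for i, j ∈ {0,1}, the cardinality |(D_i^{(p^n)} + r) ∩ D_j^{(p^n)}| equals p^{n-1}(p-1)/2 if i = j, and equals 0 if i ≠ j. -/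
theorem sq_shift (p n : ℕ) (hodd : Odd p) (hn : 0 < n)
    (s : ZMod (p ^ n)) (hs : (p : ZMod (p ^ n)) ∣ s) :
    IsUnit (1 + s) ∧ IsSquare (1 + s) := by
  have h1 : (1 + s) ^ p ^ (n - 1) = 1 := by
    have h := dvd_sub_pow_of_dvd_sub (R := ZMod (p ^ n)) (p := p) (a := 1 + s) (b := 1)
      (by simpa using hs) (n - 1)
    rw [Nat.sub_add_cancel hn] at h
    have h0 : (p : ZMod (p ^ n)) ^ n = 0 := by
      have := ZMod.natCast_self (p ^ n)
      push_cast at this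
      exact this
    rw [h0, zero_dvd_iff, one_pow, sub_eq_zero] at h
    exact h
  have ho : Odd (p ^ (n - 1)) := hodd.pow
  refine ⟨IsUnit.of_pow_eq_one h1 (Nat.ne_of_gt ho.pos), ?_⟩
  obtain ⟨m, hm⟩ := ho
  refine ⟨(1 + s) ^ (m + 1), ?_⟩
  have : (1 + s) ^ (m + 1) * (1 + s) ^ (m + 1) = (1 + s) ^ (p ^ (n - 1)) * (1 + s) := by
    rw [hm]; ring
  rw [this, h1, one_mul]

theorem unit_sq_shift (p n : ℕ) (hodd : Odd p) (hn : 0 < n)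
    (x r : ZMod (p ^ n)) (hx : IsUnit x) (hr : (p : ZMod (p ^ n)) ∣ r) :
    IsUnit (x + r) ∧ (IsSquare x → IsSquare (x + r)) := by
  obtain ⟨u, rfl⟩ := hx
  have h := sq_shift p n hodd hn (↑u⁻¹ * r) (hr.mul_left _)
  have e : (u : ZMod (p ^ n)) + r = u * (1 + ↑u⁻¹ * r) := by
    rw [mul_add, mul_one, Units.mul_inv_cancel_left]
  rw [e]
  exact ⟨u.isUnit.mul h.1, fun hs => hs.mul h.2⟩

theorem DH_shift (p n : ℕ) (hodd : Odd p) (hn : 0 < n) (i : ℕ)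
    (x r : ZMod (p ^ n)) (hx : x ∈ DH (p ^ n) i) (hr : (p : ZMod (p ^ n)) ∣ r) :
    x + r ∈ DH (p ^ n) i := by
  obtain ⟨hu, hs⟩ := hx
  have h1 := unit_sq_shift p n hodd hn x r hu hr
  have h2 := unit_sq_shift p n hodd hn (x + r) (-r) h1.1 (hr.neg_right)
  rw [add_neg_cancel_right] at h2
  exact ⟨h1.1, (Iff.intro h2.2 h1.2).trans hs⟩

theorem DH_image (p n : ℕ) (hodd : Odd p) (hn : 0 < n) (i : ℕ)
    (r : ZMod (p ^ n)) (hr : (p : ZMod (p ^ n)) ∣ r) :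
    (· + r) '' DH (p ^ n) i = DH (p ^ n) i := by
  ext y
  constructor
  · rintro ⟨x, hx, rfl⟩
    exact DH_shift p n hodd hn i x r hx hr
  · intro hy
    exact ⟨y + -r, DH_shift p n hodd hn i y (-r) hy hr.neg_right, by simp⟩

theorem isSquare_val_iff {M : Type*} [CommMonoid M] (u : Mˣ) :
    IsSquare (u : M) ↔ u ∈ (powMonoidHom 2 : Mˣ →* Mˣ).range := by
  constructor
  · rintro ⟨y, hy⟩
    have hyu : IsUnit y := isUnit_of_mul_isUnit_left (hy ▸ u.isUnit)
    obtain ⟨v, rfl⟩ := hyu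
    refine ⟨v, Units.ext ?_⟩
    simp [hy, sq]
  · rintro ⟨v, rfl⟩
    exact ⟨v, by simp [sq]⟩

theorem DH_card (p n : ℕ) (hp : p.Prime) (hodd : Odd p) (hn : 0 < n) (i : ℕ) (hi : i < 2) :
    (DH (p ^ n) i).ncard = p ^ (n - 1) * (p - 1) / 2 := by
  have : NeZero (p ^ n) := ⟨pow_ne_zero _ hp.ne_zero⟩
  have hp2 : p ≠ 2 := by rintro rfl; revert hodd; decide
  have := ZMod.isCyclic_units_of_prime_pow p hp hp2 n
  have hc : Nat.card (ZMod (p ^ n))ˣ = p ^ (n - 1) * (p - 1) := by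
    rw [Nat.card_eq_fintype_card, ZMod.card_units_eq_totient, Nat.totient_prime_pow hp hn]
  have hev : 2 ∣ p ^ (n - 1) * (p - 1) := by
    obtain ⟨m, hm⟩ := hodd
    exact Dvd.dvd.mul_left ⟨m, by omega⟩ _
  have hr := IsCyclic.card_powMonoidHom_range (G := (ZMod (p ^ n))ˣ) 2
  rw [hc, Nat.gcd_eq_right hev] at hr
  set H := (powMonoidHom 2 : (ZMod (p ^ n))ˣ →* (ZMod (p ^ n))ˣ).range with hH
  have hH1 : (H : Set (ZMod (p ^ n))ˣ).ncard = p ^ (n - 1) * (p - 1) / 2 := hr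
  have hH2 : (H : Set (ZMod (p ^ n))ˣ)ᶜ.ncard = p ^ (n - 1) * (p - 1) / 2 := by
    have := Set.ncard_add_ncard_compl (H : Set (ZMod (p ^ n))ˣ)
    omega
  have e : ∀ S : Set (ZMod (p ^ n))ˣ, (Units.val '' S).ncard = S.ncard := fun S =>
    Set.ncard_image_of_injective S Units.val_injective
  interval_cases i
  · rw [← hH1, ← e]
    congr 1
    ext x
    constructor
    · rintro ⟨⟨u, rfl⟩, h⟩
      exact ⟨u, (isSquare_val_iff u).1 (h.2 rfl), rfl⟩
    · rintro ⟨u, hu, rfl⟩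
      exact ⟨u.isUnit, iff_of_true ((isSquare_val_iff u).2 hu) rfl⟩
  · rw [← hH2, ← e]
    congr 1
    ext x
    constructor
    · rintro ⟨⟨u, rfl⟩, h⟩
      exact ⟨u, fun hu => absurd (h.1 ((isSquare_val_iff u).2 hu)) (by decide), rfl⟩
    · rintro ⟨u, hu, rfl⟩
      exact ⟨u.isUnit, iff_of_false (fun h => hu ((isSquare_val_iff u).1 h)) (by decide)⟩

theorem stmt_4 (p n : ℕ) (hp : p.Prime) (hodd : Odd p) (hn : 0 < n)
    (r : ZMod (p ^ n)) (hr : r ∈ Rset p n) (i j : ℕ) (hi : i < 2) (hj : j < 2) :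
    (((· + r) '' DH (p ^ n) i) ∩ DH (p ^ n) j).ncard =
      if i = j then p ^ (n - 1) * (p - 1) / 2 else 0 := by
  rw [DH_image p n hodd hn i r hr]
  split_ifs with h
  · subst h
    rw [Set.inter_self, DH_card p n hp hodd hn i hi]
  · have he : DH (p ^ n) i ∩ DH (p ^ n) j = ∅ := by
      ext x
      simp only [Set.mem_inter_iff, Set.mem_empty_iff_false, iff_false]
      rintro ⟨⟨_, h1⟩, ⟨_, h2⟩⟩
      have h3 := h1.symm.trans h2
      omega
    rw [he, Set.ncard_empty]
end

section
/- Let p be an odd prime and n ≥ 2 an integer. Then both Gaussian periods based on the Ding–Helleseth generalized cyclotomic classes of order 2 modulo p^n vanish: η_0^{(p^n)} = 0 and η_1^{(p^n)} = 0. -/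
open scoped Classical

/-- The Gaussian period `η_i^{(p^n)}`: the sum of `ω^x̃` over the
Ding–Helleseth generalized cyclotomic class `D_i^{(p^n)}` (the square units
of `ZMod (p^n)` for `i = 0`, the non-square units for `i = 1`), where
`ω = e^{2πi/p^n}` and `x̃ ∈ {0, ..., p^n - 1}` is the integer representative. -/
noncomputable def etaPow (p n : ℕ) (i : ℕ) : ℂ :=
  ∑ k ∈ (Finset.range (p ^ n)).filter
      (fun k : ℕ => IsUnit ((k : ZMod (p ^ n))) ∧
        (IsSquare ((k : ZMod (p ^ n))) ↔ i % 2 = 0)),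
    Complex.exp (2 * (Real.pi : ℂ) * Complex.I * (k : ℂ) / ((p : ℂ) ^ n))

theorem unit_shift_aux {R : Type*} [CommRing R] {x q : R} (hq : q * q = 0)
    (hx : IsUnit x) : IsUnit (x + q) := by
  have h : IsUnit ((x + q) * (x - q)) := by
    have : (x + q) * (x - q) = x * x := by linear_combination -hq
    rw [this]
    exact hx.mul hx
  exact isUnit_of_mul_isUnit_left h

theorem square_shift_aux {R : Type*} [CommRing R] {x q : R} (hq : q * q = 0)
    (h2 : IsUnit (2 : R)) (hx : IsUnit x) (hs : IsSquare x) : IsSquare (x + q) := by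
  obtain ⟨y, rfl⟩ := hs
  have hy : IsUnit y := isUnit_of_mul_isUnit_left hx
  obtain ⟨z, hz⟩ := (h2.mul hy).exists_right_inv
  refine ⟨y + q * z, ?_⟩
  linear_combination (-q) * hz - z * z * hq

theorem class_shift_aux {R : Type*} [CommRing R] {x q : R} (hq : q * q = 0)
    (h2 : IsUnit (2 : R)) (P : Prop) :
    (IsUnit (x + q) ∧ (IsSquare (x + q) ↔ P)) ↔ (IsUnit x ∧ (IsSquare x ↔ P)) := by
  have hq' : (-q) * (-q) = 0 := by linear_combination hq
  have hu : IsUnit (x + q) ↔ IsUnit x :=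
    ⟨fun h => by simpa using unit_shift_aux hq' h, unit_shift_aux hq⟩
  rw [hu]
  refine and_congr_right fun hx => ?_
  have hs : IsSquare (x + q) ↔ IsSquare x :=
    ⟨fun h => by simpa using square_shift_aux hq' h2 (hu.2 hx) h, square_shift_aux hq h2 hx⟩
  rw [hs]

theorem eta_zero_aux (p n : ℕ) (hp : p.Prime) (hodd : Odd p) (hn : 2 ≤ n) (i : ℕ) :
    etaPow p n i = 0 := by
  have : NeZero (p ^ n) := ⟨pow_ne_zero _ hp.ne_zero⟩
  have key : etaPow p n i = ∑ x : ZMod (p ^ n),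
      if IsUnit x ∧ (IsSquare x ↔ i % 2 = 0) then ZMod.stdAddChar x else 0 := by
    unfold etaPow
    rw [← Finset.sum_filter]
    refine Finset.sum_bij' (fun k _ => (k : ZMod (p ^ n))) (fun x _ => x.val) ?_ ?_ ?_ ?_ ?_
    · intro k hk
      simp only [Finset.mem_filter, Finset.mem_univ, true_and] at hk ⊢
      exact hk.2
    · intro x hx
      simpa [ZMod.val_lt] using hx
    · intro k hk
      simp only [Finset.mem_filter, Finset.mem_range] at hk
      exact ZMod.val_cast_of_lt hk.1
    · intro x hx
      simp
    · intro k hk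
      have := ZMod.stdAddChar_coe (N := p ^ n) (k : ℤ)
      push_cast at this
      rw [this]
  set q : ZMod (p ^ n) := ((p ^ (n - 1) : ℕ) : ZMod (p ^ n)) with hqd
  have hq : q * q = 0 := by
    rw [hqd, ← Nat.cast_mul, ZMod.natCast_eq_zero_iff, ← pow_add]
    exact pow_dvd_pow _ (by omega)
  have hq0 : q ≠ 0 := by
    rw [hqd, Ne, ZMod.natCast_eq_zero_iff, Nat.pow_dvd_pow_iff_le_right hp.one_lt]
    omega
  have h2 : IsUnit (2 : ZMod (p ^ n)) := by
    have := (ZMod.isUnit_iff_coprime 2 (p ^ n)).2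
      (Nat.Coprime.pow_right _ (Nat.coprime_two_left.2 hodd))
    simpa using this
  have hne : (ZMod.stdAddChar q : ℂ) ≠ 1 := by
    intro h
    apply hq0
    apply ZMod.injective_stdAddChar
    rw [h, AddChar.map_zero_eq_one]
  have hshift : etaPow p n i = ZMod.stdAddChar q * etaPow p n i := by
    conv_lhs => rw [key]
    rw [key, Finset.mul_sum, ← Equiv.sum_comp (Equiv.addRight q)]
    refine Finset.sum_congr rfl fun x _ => ?_
    simp only [Equiv.coe_addRight, class_shift_aux hq h2, AddChar.map_add_eq_mul]
    split_ifs <;> ring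
  have : (ZMod.stdAddChar q - 1) * etaPow p n i = 0 := by linear_combination -hshift
  exact (mul_eq_zero.1 this).resolve_left (sub_ne_zero.2 hne)

theorem stmt_9 (p n : ℕ) (hp : p.Prime) (hodd : Odd p) (hn : 2 ≤ n) :
    etaPow p n 0 = 0 ∧ etaPow p n 1 = 0 :=
  ⟨eta_zero_aux p n hp hodd hn 0, eta_zero_aux p n hp hodd hn 1⟩
end

section
/- Let (s_i)_{0≤i<N} be a binary sequence of period N, let S(x) = ∑_{i=0}^{N-1} s_i x^i, and let A be the N×N integer circulant matrix with entries a_{i,j} = s_{(i−j) mod N}. If det(A) ≠ 0, then gcd(S(2), 2^N − 1) divides gcd(det(A), 2^N − 1). -/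
theorem stmt_11 (N : ℕ) (hN : 0 < N) (s : ℕ → ℕ) (hs : ∀ i < N, s i ≤ 1)
    (A : Matrix (Fin N) (Fin N) ℤ)
    (hA : ∀ i j : Fin N, A i j = (s ((i - j : Fin N).val) : ℤ))
    (hdet : A.det ≠ 0) :
    Nat.gcd (∑ i ∈ Finset.range N, s i * 2 ^ i) (2 ^ N - 1) ∣
      Nat.gcd A.det.natAbs (2 ^ N - 1) := by
  obtain ⟨n, rfl⟩ : ∃ n, N = n + 1 := ⟨N - 1, by omega⟩
  refine Nat.dvd_gcd ?_ (Nat.gcd_dvd_right _ _)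
  obtain ⟨g, hg⟩ : ∃ g, g = Nat.gcd (∑ i ∈ Finset.range (n + 1), s i * 2 ^ i) (2 ^ (n + 1) - 1) :=
    ⟨_, rfl⟩
  have h1 : g ∣ ∑ i ∈ Finset.range (n + 1), s i * 2 ^ i := hg ▸ Nat.gcd_dvd_left _ _
  have h2 : g ∣ 2 ^ (n + 1) - 1 := hg ▸ Nat.gcd_dvd_right _ _
  rw [← hg, ← Int.natCast_dvd, ← ZMod.intCast_zmod_eq_zero_iff_dvd]
  rw [← ZMod.natCast_eq_zero_iff] at h1 h2
  rw [Nat.cast_sub Nat.one_le_two_pow] at h2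
  push_cast at h1 h2
  have hpow : (2 : ZMod g) ^ (n + 1) = 1 := sub_eq_zero.mp h2
  have hmod : ∀ m, (2 : ZMod g) ^ (m % (n + 1)) = 2 ^ m := by
    intro m
    conv_rhs => rw [← Nat.mod_add_div m (n + 1), pow_add, pow_mul, hpow, one_pow, mul_one]
  let B : Matrix (Fin (n + 1)) (Fin (n + 1)) (ZMod g) := A.map (Int.castRingHom (ZMod g))
  let v : Fin (n + 1) → ZMod g := fun i => 2 ^ (i : ℕ)
  have hv : Matrix.vecMul v B = 0 := by
    funext j
    change ∑ i, v i * B i j = 0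
    rw [← Equiv.sum_comp (Equiv.addRight j)]
    have : ∀ k : Fin (n + 1), v (Equiv.addRight j k) * B (Equiv.addRight j k) j
        = 2 ^ (j : ℕ) * ((s k : ZMod g) * 2 ^ (k : ℕ)) := by
      intro k
      simp only [v, B, Matrix.map_apply, hA, Equiv.coe_addRight, add_sub_cancel_right, Fin.val_add,
        hmod, pow_add]
      simp
      ring
    rw [Finset.sum_congr rfl (fun k _ => this k), ← Finset.mul_sum,
      Fin.sum_univ_eq_sum_range (fun k => (s k : ZMod g) * 2 ^ k), h1, mul_zero]
  have h3 : Matrix.vecMul v (B * B.adjugate) = 0 := by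
    rw [← Matrix.vecMul_vecMul, hv, Matrix.zero_vecMul]
  rw [Matrix.mul_adjugate] at h3
  have h4 := congrFun h3 0
  have h5 : B.det = 0 := by simpa [v, Matrix.vecMul_smul] using h4
  have h6 : ((A.det : ℤ) : ZMod g) = B.det := by
    simpa [B] using (Int.castRingHom (ZMod g)).map_det A
  rw [h6, h5]
end

section
/- Let p be an odd prime, n a positive integer, N = p^n, and let (s_i)_{0≤i<N} be the Ding–Helleseth generalized cyclotomic sequence of period N with S(x) = ∑_{i=0}^{N-1} s_i x^i. Let ω_N = e^{2πi/N}. Then S(1) = (p^n+1)/2, and for every integer m with 0 ≤ m ≤ n−1 and every integer a of the form a = p^m·b where b is an integer coprime to p that is a quadratic residue modulo p (i.e., a mod p^n lies in p^m·D_0^{(p^{n-m})}), one has S(ω_N^a) = (p^m+1)/2 + p^m·η_1^{(p)}. -/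
open scoped Classical

/-- The `i`-th term of the Ding–Helleseth generalized cyclotomic sequence:
`dh p i = 1` if `i = 0` or if, writing `i = p^j·u` with `p ∤ u`, the integer
`u` is a quadratic non-residue modulo `p`; and `dh p i = 0` otherwise. -/
noncomputable def dh (p : ℕ) (i : ℕ) : ℕ :=
  if i = 0 ∨ ¬ IsSquare (((i / p ^ padicValNat p i : ℕ) : ZMod p)) then 1 else 0

/-- The Gaussian period `η_i^{(p)}`: the sum of `e^{2πic/p}` over the
quadratic residues (`i = 0`) resp. non-residues (`i = 1`) `c` modulo `p`
in `{1, ..., p-1}`. -/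
noncomputable def eta (p : ℕ) (i : ℕ) : ℂ :=
  ∑ c ∈ (Finset.range p).filter
      (fun c : ℕ => c ≠ 0 ∧ (IsSquare ((c : ZMod p)) ↔ i % 2 = 0)),
    Complex.exp (2 * (Real.pi : ℂ) * Complex.I * (c : ℂ) / (p : ℂ))

lemma dh_zero (p : ℕ) : dh p 0 = 1 := by simp [dh]

lemma dh_mul (p : ℕ) (hp : p.Prime) (q : ℕ) : dh p (p * q) = dh p q := by
  haveI := Fact.mk hp
  rcases Nat.eq_zero_or_pos q with rfl | hq
  · simp
  · have h1 : padicValNat p (p * q) = padicValNat p q + 1 := by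
      rw [padicValNat.mul hp.ne_zero hq.ne', padicValNat_self, add_comm]
    have h2 : p * q / p ^ (padicValNat p q + 1) = q / p ^ padicValNat p q := by
      rw [pow_succ', Nat.mul_div_mul_left _ _ hp.pos]
    have h3 : (p * q = 0) ↔ (q = 0) := by simp [hp.ne_zero]
    unfold dh
    rw [h1, h2]
    simp only [h3]
    congr 1

/-- Indicator of non-residues. -/
noncomputable def nr (p : ℕ) (x : ZMod p) : ℂ := if IsSquare x then 0 else 1

lemma dh_add (p : ℕ) (hp : p.Prime) (q r : ℕ) (hr : r < p) (hr0 : r ≠ 0) :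
    (dh p (p * q + r) : ℂ) = nr p (r : ZMod p) := by
  have hnd : ¬ p ∣ p * q + r := by
    intro h
    have := (Nat.dvd_add_right (Dvd.intro q rfl)).1 h
    exact absurd (Nat.le_of_dvd (Nat.pos_of_ne_zero hr0) this) (by omega)
  unfold dh nr
  rw [padicValNat.eq_zero_of_not_dvd hnd]
  have : p * q + r ≠ 0 := by omega
  simp only [this, false_or, pow_zero, Nat.div_one]
  push_cast
  simp only [CharP.cast_eq_zero, zero_mul, zero_add]
  split_ifs <;> simp_all

lemma sum_split (p M : ℕ) (f : ℕ → ℂ) :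
    ∑ i ∈ Finset.range (p * M), f i
      = ∑ q ∈ Finset.range M, ∑ r ∈ Finset.range p, f (p * q + r) := by
  induction M with
  | zero => simp
  | succ M ih => rw [Nat.mul_succ, Finset.sum_range_add, ih, Finset.sum_range_succ]

noncomputable def TT (p k : ℕ) (z : ℂ) : ℂ := ∑ i ∈ Finset.range (p ^ k), (dh p i : ℂ) * z ^ i

noncomputable def EE (p : ℕ) (z : ℂ) : ℂ := ∑ r ∈ Finset.range p, nr p (r : ZMod p) * z ^ r

lemma TT_succ (p k : ℕ) (hp : p.Prime) (z : ℂ) :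
    TT p (k + 1) z = (∑ q ∈ Finset.range (p ^ k), (z ^ p) ^ q) * EE p z + TT p k (z ^ p) := by
  unfold TT EE
  rw [pow_succ', sum_split, Finset.sum_mul, ← Finset.sum_add_distrib]
  refine Finset.sum_congr rfl fun q _ => ?_
  have hp0 : 0 ∈ Finset.range p := Finset.mem_range.2 hp.pos
  rw [← Finset.add_sum_erase _ _ hp0, ← Finset.add_sum_erase (Finset.range p) (fun r : ℕ => nr p (r : ZMod p) * z ^ r) hp0]
  have h0 : nr p ((0 : ℕ) : ZMod p) = 0 := by simp [nr]
  rw [h0, add_zero, dh_mul p hp, zero_mul, zero_add, Finset.mul_sum, add_comm, ← pow_mul]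
  congr 1
  refine Finset.sum_congr rfl fun r hr => ?_
  rw [Finset.mem_erase, Finset.mem_range] at hr
  rw [dh_add p hp q r hr.2 hr.1, pow_add]
  ring

lemma sum_zmod (p : ℕ) [NeZero p] (f : ZMod p → ℂ) :
    ∑ r ∈ Finset.range p, f (r : ZMod p) = ∑ x : ZMod p, f x := by
  refine Finset.sum_bij' (fun r _ => (r : ZMod p)) (fun x _ => x.val) ?_ ?_ ?_ ?_ ?_
  · simp
  · intro x _; exact Finset.mem_range.2 (ZMod.val_lt x)
  · intro r hr; exact ZMod.val_cast_of_lt (Finset.mem_range.1 hr)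
  · intro x _; simp
  · simp

lemma EE_one (p : ℕ) (hp : p.Prime) (hodd : Odd p) : 2 * EE p 1 = (p : ℂ) - 1 := by
  haveI := Fact.mk hp
  have hch : ringChar (ZMod p) ≠ 2 := by
    rw [ZMod.ringChar_zmod_n]; rintro rfl; exact absurd hodd (by decide)
  have hs : ∑ x : ZMod p, ((quadraticChar (ZMod p) x : ℤ) : ℂ) = 0 := by
    exact_mod_cast quadraticChar_sum_zero hch
  have key : ∀ x : ZMod p, 2 * nr p x
      = 1 - ((quadraticChar (ZMod p) x : ℤ) : ℂ) - (if x = 0 then 1 else 0) := by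
    intro x
    unfold nr
    rw [quadraticChar_apply, quadraticCharFun]
    split_ifs <;> simp_all <;> norm_num
  unfold EE
  simp only [one_pow, mul_one]
  rw [sum_zmod p (nr p), Finset.mul_sum, Finset.sum_congr rfl fun x _ => key x]
  rw [Finset.sum_sub_distrib, Finset.sum_sub_distrib, hs]
  simp

lemma TT_one (p k : ℕ) (hp : p.Prime) (hodd : Odd p) : 2 * TT p k 1 = (p : ℂ) ^ k + 1 := by
  induction k with
  | zero => simp [TT, dh_zero]; norm_num
  | succ k ih =>
    rw [TT_succ p k hp, one_pow, mul_add, ih]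
    simp only [one_pow, Finset.sum_const, Finset.card_range, nsmul_eq_mul, mul_one]
    push_cast
    rw [mul_left_comm, EE_one p hp hodd]
    ring

lemma eta_eq (p : ℕ) [NeZero p] : eta p 1 = ∑ x : ZMod p, nr p x * ZMod.stdAddChar x := by
  rw [← sum_zmod p (fun x => nr p x * ZMod.stdAddChar x)]
  unfold eta
  rw [Finset.sum_filter]
  refine Finset.sum_congr rfl fun r _ => ?_
  have h := ZMod.stdAddChar_coe (N := p) (r : ℤ)
  simp only [Int.cast_natCast] at h
  rw [h]
  unfold nr
  by_cases hr : IsSquare (r : ZMod p)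
  · simp [hr]
  · have : r ≠ 0 := by rintro rfl; simp at hr
    simp [hr, this]

lemma EE_eq (p : ℕ) (hp : p.Prime) (b : ℤ) (hb : ¬ (p : ℤ) ∣ b) (hsq : IsSquare (b : ZMod p)) :
    EE p (Complex.exp (2 * (Real.pi : ℂ) * Complex.I * (b : ℂ) / (p : ℂ))) = eta p 1 := by
  haveI := Fact.mk hp
  have hb0 : (b : ZMod p) ≠ 0 := by rwa [Ne, ZMod.intCast_zmod_eq_zero_iff_dvd]
  rw [eta_eq, ← Equiv.sum_comp (Equiv.mulLeft₀ (b : ZMod p) hb0)]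
  rw [← sum_zmod p]
  unfold EE
  refine Finset.sum_congr rfl fun r _ => ?_
  simp only [Equiv.mulLeft₀_apply]
  have h1 : nr p ((b : ZMod p) * r) = nr p (r : ZMod p) := by
    have : IsSquare ((b : ZMod p) * r) ↔ IsSquare (r : ZMod p) := by
      constructor
      · intro h
        have := hsq.inv.mul h
        rwa [inv_mul_cancel_left₀ hb0] at this
      · exact fun h => hsq.mul h
    unfold nr
    simp only [this]
    congr 1
  have h := ZMod.stdAddChar_coe (N := p) (b * r : ℤ)
  push_cast at h
  rw [h1, h, ← Complex.exp_nat_mul]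
  congr 2
  ring

lemma TT_main (p : ℕ) (hp : p.Prime) (hodd : Odd p) (b : ℤ) (hb : ¬ (p : ℤ) ∣ b)
    (hsq : IsSquare (b : ZMod p)) (m k : ℕ) (hmk : m ≤ k) :
    TT p (k + 1) (Complex.exp (2 * (Real.pi : ℂ) * Complex.I * ((p : ℂ) ^ m * (b : ℂ))
      / (p : ℂ) ^ (k + 1))) = ((p : ℂ) ^ m + 1) / 2 + (p : ℂ) ^ m * eta p 1 := by
  have hpc : (p : ℂ) ≠ 0 := by exact_mod_cast hp.ne_zero
  have hpow : ∀ k : ℕ, (Complex.exp (2 * (Real.pi : ℂ) * Complex.I * ((p : ℂ) ^ m * (b : ℂ))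
      / (p : ℂ) ^ (k + 1))) ^ p = Complex.exp (2 * (Real.pi : ℂ) * Complex.I
        * ((p : ℂ) ^ m * (b : ℂ)) / (p : ℂ) ^ k) := by
    intro k
    rw [← Complex.exp_nat_mul]
    congr 1
    field_simp
    ring
  have h1 : Complex.exp (2 * (Real.pi : ℂ) * Complex.I * (b : ℂ)) = 1 := by
    rw [mul_comm]; exact Complex.exp_int_mul_two_pi_mul_I b
  induction k, hmk using Nat.le_induction with
  | base =>
    have e1 : 2 * (Real.pi : ℂ) * Complex.I * ((p : ℂ) ^ m * (b : ℂ)) / (p : ℂ) ^ m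
        = 2 * (Real.pi : ℂ) * Complex.I * (b : ℂ) := by
      field_simp
    have e2 : 2 * (Real.pi : ℂ) * Complex.I * ((p : ℂ) ^ m * (b : ℂ)) / (p : ℂ) ^ (m + 1)
        = 2 * (Real.pi : ℂ) * Complex.I * (b : ℂ) / (p : ℂ) := by
      field_simp
      ring
    rw [TT_succ p m hp, hpow, e1, e2, h1, EE_eq p hp b hb hsq]
    have := TT_one p m hp hodd
    simp only [one_pow, Finset.sum_const, Finset.card_range, nsmul_eq_mul, mul_one]
    push_cast
    linear_combination this / 2
  | succ k hk ih =>
    rw [TT_succ p (k + 1) hp, hpow, ih]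
    set z := Complex.exp (2 * (Real.pi : ℂ) * Complex.I
        * ((p : ℂ) ^ m * (b : ℂ)) / (p : ℂ) ^ (k + 1)) with hz
    have hz1 : z ≠ 1 := by
      rw [hz, Ne, Complex.exp_eq_one_iff]
      rintro ⟨t, ht⟩
      have hpi : (2 * (Real.pi : ℂ) * Complex.I) ≠ 0 := Complex.two_pi_I_ne_zero
      rw [div_eq_iff (pow_ne_zero _ hpc)] at ht
      have h2 : (p : ℂ) ^ m * (b : ℂ) = t * (p : ℂ) ^ (k + 1) := by
        apply mul_left_cancel₀ hpi
        linear_combination ht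
      obtain ⟨d, rfl⟩ := Nat.exists_eq_add_of_le hk
      have h3 : (b : ℂ) = p * (p ^ d * t) := by
        apply mul_left_cancel₀ (pow_ne_zero m hpc)
        rw [h2]; ring
      exact hb ⟨p ^ d * t, by exact_mod_cast h3⟩
    have hz2 : z ^ (p ^ (k + 1)) = 1 := by
      rw [hz, ← Complex.exp_nat_mul]
      have : ((p ^ (k + 1) : ℕ) : ℂ) * (2 * (Real.pi : ℂ) * Complex.I
        * ((p : ℂ) ^ m * (b : ℂ)) / (p : ℂ) ^ (k + 1)) =
          ((p ^ m : ℕ) : ℂ) * (2 * (Real.pi : ℂ) * Complex.I * (b : ℂ)) := by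
        push_cast
        field_simp
      rw [this, Complex.exp_nat_mul, h1, one_pow]
    rw [geom_sum_eq hz1, hz2]
    simp

theorem stmt_13 (p n : ℕ) (hp : p.Prime) (hodd : Odd p) (hn : 0 < n) :
    (∑ i ∈ Finset.range (p ^ n), dh p i = (p ^ n + 1) / 2) ∧
    (∀ m : ℕ, m ≤ n - 1 → ∀ b : ℤ, ¬ (p : ℤ) ∣ b → IsSquare ((b : ZMod p)) →
      ∑ i ∈ Finset.range (p ^ n), (dh p i : ℂ) *
        Complex.exp (2 * (Real.pi : ℂ) * Complex.I
          * ((p : ℂ) ^ m * (b : ℂ)) * (i : ℂ) / ((p : ℂ) ^ n))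
        = ((p : ℂ) ^ m + 1) / 2 + (p : ℂ) ^ m * eta p 1) := by
  refine ⟨?_, ?_⟩
  · have h := TT_one p n hp hodd
    have h2 : 2 * ∑ i ∈ Finset.range (p ^ n), dh p i = p ^ n + 1 := by
      simp only [TT, one_pow, mul_one] at h
      exact_mod_cast h
    omega
  · intro m hm b hb hsq
    obtain ⟨k, rfl⟩ : ∃ k, n = k + 1 := ⟨n - 1, by omega⟩
    rw [← TT_main p hp hodd b hb hsq m k (by omega)]
    unfold TT
    refine Finset.sum_congr rfl fun i _ => ?_
    rw [← Complex.exp_nat_mul]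
    congr 2
    ring
end

section
/- Let p be an odd prime, n a positive integer, N = p^n, let (s_i)_{0≤i<N} be the Ding–Helleseth generalized cyclotomic sequence of period N, and let A be the N×N integer circulant matrix with entries a_{i,j} = s_{(i−j) mod N}. If p ≡ 1 (mod 4), then det(A) = ((p^n+1)/2)·∏_{m=0}^{n-1} ((p^{2m+1}−1)/4)^{p^{n-m-1}(p-1)/2}. If p ≡ 3 (mod 4), then det(A) = ((p^n+1)/2)·∏_{m=0}^{n-1} ((p^{2m+1}+1)/4)^{p^{n-m-1}(p-1)/2}. -/
open scoped Classical

open Finset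

noncomputable def qch (p : ℕ) [Fact p.Prime] : MulChar (ZMod p) ℂ :=
  (quadraticChar (ZMod p)).ringHomComp (Int.castRingHom ℂ)

noncomputable def ff (p : ℕ) [Fact p.Prime] (i : ℕ) : ℂ :=
  if i = 0 then 0 else qch p ((i / p ^ padicValNat p i : ℕ) : ZMod p)

noncomputable def hh (p : ℕ) [Fact p.Prime] (i : ℕ) : ℂ :=
  (p : ℂ) ^ padicValNat p i * ff p i

noncomputable def zt (p n : ℕ) : ℂ := Complex.exp (2 * Real.pi * Complex.I / (p ^ n : ℕ))

noncomputable def GG (p : ℕ) [Fact p.Prime] : ℂ := gaussSum (qch p) (ZMod.stdAddChar (N := p))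

noncomputable def FF (p : ℕ) [Fact p.Prime] (n k : ℕ) : ℂ :=
  ∑ i ∈ range (p ^ n), ff p i * zt p n ^ (i * k)

@[to_additive sum_range_mul_aux]
theorem prod_range_mul_aux {M : Type*} [CommMonoid M] (g : ℕ → M) (a b : ℕ) :
    ∏ i ∈ range (a * b), g i = ∏ j ∈ range b, ∏ i ∈ range a, g (i + a * j) := by
  induction b with
  | zero => simp
  | succ b ih =>
    rw [mul_add, mul_one, prod_range_add, ih, prod_range_succ]
    congr 1
    exact prod_congr rfl fun i _ => by rw [add_comm]

@[to_additive]
theorem prod_range_zmod {M : Type*} [CommMonoid M] (p : ℕ) [NeZero p] (g : ZMod p → M) :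
    ∏ i ∈ range p, g (i : ZMod p) = ∏ a : ZMod p, g a := by
  refine prod_bij (fun i _ => (i : ZMod p)) (by simp) ?_ ?_ (by simp)
  · intro a ha b hb h
    rw [mem_range] at ha hb
    have := congrArg ZMod.val h
    rwa [ZMod.val_cast_of_lt ha, ZMod.val_cast_of_lt hb] at this
  · intro b _
    exact ⟨b.val, by simpa using ZMod.val_lt b, by simp⟩

section
variable (p : ℕ) [Fact p.Prime]

theorem ff_zero : ff p 0 = 0 := by simp [ff]

theorem hh_zero : hh p 0 = 0 := by simp [hh, ff]

theorem val_p_mul (b : ℕ) (hb : b ≠ 0) : padicValNat p (p * b) = padicValNat p b + 1 := by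
  have hp : p.Prime := Fact.out
  rw [padicValNat.mul hp.ne_zero hb, padicValNat_self, add_comm]

theorem ff_mul (b : ℕ) : ff p (p * b) = ff p b := by
  have hp : p.Prime := Fact.out
  by_cases hb : b = 0
  · simp [hb]
  · simp only [ff, hb, mul_eq_zero, hp.ne_zero, or_self, if_false]
    rw [val_p_mul p b hb, pow_succ', Nat.mul_div_mul_left _ _ hp.pos]

theorem hh_mul (b : ℕ) : hh p (p * b) = p * hh p b := by
  by_cases hb : b = 0
  · simp [hb, hh_zero]
  · rw [hh, hh, val_p_mul p b hb, ff_mul]; ring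

theorem val_unit (a : ℕ) (ha : ¬ p ∣ a) : padicValNat p a = 0 :=
  padicValNat.eq_zero_of_not_dvd ha

theorem ff_unit (a : ℕ) (ha : ¬ p ∣ a) : ff p a = qch p a := by
  have : a ≠ 0 := by rintro rfl; simp at ha
  simp [ff, this, val_unit p a ha]

theorem hh_unit (a : ℕ) (ha : ¬ p ∣ a) : hh p a = qch p a := by
  rw [hh, ff_unit p a ha, val_unit p a ha]; simp

theorem qch_zero : qch p 0 = 0 := by simp [qch]

theorem qch_cases (a : ZMod p) (ha : a ≠ 0) : qch p a = 1 ∨ qch p a = -1 := by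
  rcases quadraticChar_dichotomy ha with h | h <;> simp [qch, h]

theorem gg_sq (hodd : p ≠ 2) : GG p ^ 2 = ((ZMod.χ₄ p : ℤ) : ℂ) * p := by
  have hr : ringChar (ZMod p) ≠ 2 := by rwa [ZMod.ringChar_zmod_n]
  rw [GG, gaussSum_sq]
  · simp [qch, quadraticChar_neg_one hr]
  · have := quadraticChar_ne_one hr
    intro h
    apply this
    exact MulChar.injective_ringHomComp (f := Int.castRingHom ℂ) (RingHom.injective_int _) (by simpa [qch] using h)
  · exact (quadraticChar_isQuadratic (ZMod p)).comp _
  · exact ZMod.isPrimitive_stdAddChar p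

theorem zt_succ (n : ℕ) : zt p (n + 1) ^ p = zt p n := by
  have hp : (p : ℂ) ≠ 0 := by exact_mod_cast (Fact.out : p.Prime).ne_zero
  rw [zt, zt, ← Complex.exp_nat_mul]
  congr 1
  push_cast
  field_simp
  ring

theorem zt_prim (n : ℕ) : IsPrimitiveRoot (zt p n) (p ^ n) :=
  Complex.isPrimitiveRoot_exp _ (pow_ne_zero _ (Fact.out : p.Prime).ne_zero)

theorem zt_pow (n : ℕ) : zt p (n + 1) ^ (p ^ n) = zt p 1 := by
  have hp : (p : ℂ) ≠ 0 := by exact_mod_cast (Fact.out : p.Prime).ne_zero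
  rw [zt, zt, ← Complex.exp_nat_mul]
  congr 1
  push_cast
  field_simp
  ring

theorem std_zt (a : ℕ) : ZMod.stdAddChar (N := p) (a : ZMod p) = zt p 1 ^ a := by
  have := ZMod.stdAddChar_coe (N := p) (a : ℤ)
  push_cast at this
  rw [this, zt, ← Complex.exp_nat_mul]
  congr 1
  push_cast
  ring

theorem sum_qch (hodd : p ≠ 2) : ∑ a ∈ range p, qch p a = 0 := by
  have hr : ringChar (ZMod p) ≠ 2 := by rwa [ZMod.ringChar_zmod_n]
  rw [sum_range_zmod p (fun a => qch p a)]
  have := congrArg (Int.cast : ℤ → ℂ) (quadraticChar_sum_zero hr)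
  push_cast at this
  simpa [qch] using this

theorem gauss_shift (hodd : p ≠ 2) (k : ℕ) :
    ∑ a ∈ range p, qch p a * zt p 1 ^ (a * k) = if p ∣ k then 0 else qch p k * GG p := by
  have hp : p.Prime := Fact.out
  have e : ∑ a ∈ range p, qch p a * zt p 1 ^ (a * k) =
      gaussSum (qch p) ((ZMod.stdAddChar (N := p)).mulShift (k : ZMod p)) := by
    rw [gaussSum, ← sum_range_zmod]
    refine sum_congr rfl fun a _ => ?_
    rw [AddChar.mulShift_apply, ← Nat.cast_mul, std_zt, mul_comm k]
  split_ifs with h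
  · have h1 : zt p 1 ^ k = 1 := ((zt_prim p 1).pow_eq_one_iff_dvd k).2 (by simpa using h)
    simp only [mul_comm _ k, pow_mul, h1, one_pow, mul_one]
    exact sum_qch p hodd
  · have hk : (k : ZMod p) ≠ 0 := by rwa [Ne, ZMod.natCast_eq_zero_iff]
    have := gaussSum_mulShift (qch p) (ZMod.stdAddChar (N := p)) (Units.mk0 _ hk)
    rw [Units.val_mk0] at this
    rw [e, GG, ← this]
    rcases qch_cases p k hk with h | h <;> rw [h] <;> ring

theorem geom_zt (n k : ℕ) :
    ∑ b ∈ range (p ^ n), zt p n ^ (b * k) = if p ^ n ∣ k then (p : ℂ) ^ n else 0 := by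
  split_ifs with h
  · have : zt p n ^ k = 1 := ((zt_prim p n).pow_eq_one_iff_dvd k).2 h
    simp [mul_comm _ k, pow_mul, this]
  · have h1 : zt p n ^ k ≠ 1 := fun h' => h (((zt_prim p n).pow_eq_one_iff_dvd k).1 h')
    have := mul_geom_sum (zt p n ^ k) (p ^ n)
    rw [← pow_mul, mul_comm k, pow_mul, (zt_prim p n).pow_eq_one, one_pow, sub_self] at this
    simpa [mul_comm _ k, pow_mul, sub_eq_zero, h1] using this

theorem not_dvd_of (a b : ℕ) (ha : a < p) (h0 : a ≠ 0) : ¬ p ∣ a + p * b := by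
  rw [← Nat.dvd_add_iff_left (dvd_mul_right _ _)]
  exact Nat.not_dvd_of_pos_of_lt (Nat.pos_of_ne_zero h0) ha

theorem FF_succ (hodd : p ≠ 2) (n k : ℕ) : FF p (n + 1) k = FF p n k +
    if p ^ n ∣ k then (p : ℂ) ^ n * (if p ∣ k / p ^ n then 0 else qch p (k / p ^ n : ℕ) * GG p) else 0 := by
  have hp : p.Prime := Fact.out
  obtain ⟨q, hq⟩ : ∃ q, p = q + 1 := ⟨p - 1, by have := hp.pos; omega⟩
  have key : FF p (n + 1) k = FF p n k +
    (∑ a ∈ range p, qch p a * zt p (n + 1) ^ (a * k)) * ∑ b ∈ range (p ^ n), zt p n ^ (b * k) := by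
    rw [FF, FF, pow_succ', sum_range_mul_aux, mul_sum, ← sum_add_distrib]
    refine sum_congr rfl fun b _ => ?_
    have e : ∀ a, zt p (n + 1) ^ ((a + p * b) * k) = zt p (n + 1) ^ (a * k) * zt p n ^ (b * k) := by
      intro a
      rw [← zt_succ p n, ← pow_mul, ← pow_add]; congr 1; ring
    have hr : range p = insert 0 ((range p).erase 0) := (insert_erase (by simp [hp.pos])).symm
    rw [hr, sum_insert (by simp), sum_insert (by simp), e]
    simp only [zero_add, ff_mul, Nat.cast_zero, qch_zero, zero_mul, pow_zero, one_mul]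
    congr 1
    rw [sum_mul]
    refine sum_congr rfl fun a ha => ?_
    simp only [mem_erase, mem_range] at ha
    rw [e, ff_unit p _ (not_dvd_of p a b ha.2 ha.1)]
    simp [mul_assoc]
  rw [key, geom_zt]
  congr 1
  split_ifs with h h2
  · obtain ⟨c, rfl⟩ := h
    rw [Nat.mul_div_cancel_left _ (pow_pos hp.pos _)] at h2
    have := gauss_shift p hodd c
    rw [if_pos h2] at this
    simp only [mul_left_comm _ (p ^ n), pow_mul _ (p ^ n), zt_pow, this]
    simp
  · obtain ⟨c, rfl⟩ := h
    rw [Nat.mul_div_cancel_left _ (pow_pos hp.pos _)] at h2 ⊢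
    have := gauss_shift p hodd c
    rw [if_neg h2] at this
    simp only [mul_left_comm _ (p ^ n), pow_mul _ (p ^ n), zt_pow, this]
    ring
  · simp

theorem FF_dvd (hodd : p ≠ 2) (n k : ℕ) (h : p ^ n ∣ k) : FF p n k = 0 := by
  have hp : p.Prime := Fact.out
  induction n with
  | zero => simp [FF, ff_zero]
  | succ n ih =>
    have h1 : p ^ n ∣ k := (pow_dvd_pow p (Nat.le_succ n)).trans h
    obtain ⟨c, rfl⟩ := h
    rw [FF_succ p hodd, ih h1, if_pos h1, if_pos]
    · simp
    · rw [pow_succ, mul_assoc, Nat.mul_div_cancel_left _ (pow_pos hp.pos _)]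
      exact dvd_mul_right _ _

theorem hh_pow_mul (m c : ℕ) : hh p (p ^ m * c) = p ^ m * hh p c := by
  induction m with
  | zero => simp
  | succ m ih => rw [pow_succ', mul_assoc, hh_mul, ih]; ring

theorem FF_eq (hodd : p ≠ 2) (n m c : ℕ) (hc : ¬ p ∣ c) (hm : m < n) :
    FF p n (p ^ m * c) = hh p (p ^ m * c) * GG p := by
  have hp : p.Prime := Fact.out
  induction n with
  | zero => omega
  | succ n ih =>
    rw [FF_succ p hodd]
    rcases Nat.lt_succ_iff_lt_or_eq.1 hm with h | rfl
    · rw [ih h, if_neg, add_zero]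
      intro h'
      apply hc
      have : p ^ m * p ∣ p ^ m * c := by
        rw [← pow_succ]; exact (pow_dvd_pow p h).trans h'
      exact Nat.dvd_of_mul_dvd_mul_left (pow_pos hp.pos _) this
    · rw [FF_dvd p hodd m _ (dvd_mul_right _ _), if_pos (dvd_mul_right _ _),
        Nat.mul_div_cancel_left _ (pow_pos hp.pos _), if_neg hc, hh_pow_mul, hh_unit p c hc]
      ring

theorem FF_lt (hodd : p ≠ 2) (n k : ℕ) (hk : k < p ^ n) : FF p n k = hh p k * GG p := by
  have hp : p.Prime := Fact.out
  by_cases h0 : k = 0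
  · subst h0; rw [FF_dvd p hodd n 0 (dvd_zero _), hh_zero, zero_mul]
  · obtain ⟨m, c, hc, rfl⟩ := Nat.exists_eq_pow_mul_and_not_dvd h0 p hp.ne_one
    apply FF_eq p hodd n m c hc
    by_contra hmn
    push Not at hmn
    have := Nat.le_of_dvd (Nat.pos_of_ne_zero h0) ((pow_dvd_pow p hmn).trans (dvd_mul_right _ c))
    omega

theorem prod_unit (hodd : p ≠ 2) (x : ℂ) :
    ∏ a ∈ (range p).erase 0, ((1 - qch p a * x) / 2) = ((1 - x ^ 2) / 4) ^ ((p - 1) / 2) := by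
  have hp : p.Prime := Fact.out
  set s := (range p).erase 0 with hs
  have hne : ∀ a ∈ s, ((a : ℕ) : ZMod p) ≠ 0 := by
    intro a ha
    simp only [hs, mem_erase, mem_range] at ha
    rw [Ne, ZMod.natCast_eq_zero_iff]
    exact Nat.not_dvd_of_pos_of_lt (Nat.pos_of_ne_zero ha.1) ha.2
  have h11 : ¬ ((-1 : ℂ) = 1) := by norm_num
  have h1 : ∀ a ∈ s, (1 - qch p a * x) / 2 = if qch p a = 1 then (1 - x) / 2 else (1 + x) / 2 := by
    intro a ha
    rcases qch_cases p a (hne a ha) with h | h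
    · rw [h, if_pos rfl]; ring
    · rw [h, if_neg h11]; ring
  have h2 : ∀ a ∈ s, qch p a = if qch p a = 1 then (1 : ℂ) else -1 := by
    intro a ha
    rcases qch_cases p a (hne a ha) with h | h
    · rw [h, if_pos rfl]
    · rw [h, if_neg h11]
  have h3 : ∑ a ∈ s, qch p a = 0 := by
    rw [hs, sum_erase _ (by simp [qch_zero]), sum_qch p hodd]
  rw [sum_congr rfl h2, sum_ite, sum_const, sum_const] at h3
  have h4 := card_filter_add_card_filter_not (s := s) (fun a : ℕ => qch p a = 1)
  have h5 : #s = p - 1 := by rw [hs, card_erase_of_mem (by simp [hp.pos]), card_range]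
  have h6 : #(s.filter fun a : ℕ => qch p (a : ZMod p) = 1) = #(s.filter fun a : ℕ => ¬ qch p (a : ZMod p) = 1) := by
    have : (#(s.filter fun a : ℕ => qch p (a : ZMod p) = 1) : ℂ) = #(s.filter fun a : ℕ => ¬ qch p (a : ZMod p) = 1) := by
      simpa [add_neg_eq_zero] using h3
    exact_mod_cast this
  rw [prod_congr rfl h1, prod_ite, prod_const, prod_const, ← h6, ← mul_pow]
  have h7 : #(s.filter fun a : ℕ => qch p (a : ZMod p) = 1) = (p - 1) / 2 := by omega
  rw [h7]
  congr 1
  ring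

theorem prod_hh (hodd : p ≠ 2) (n : ℕ) (c : ℂ) :
    ∏ k ∈ range (p ^ n), ((1 - hh p k * c) / 2) =
    (1 / 2) * ∏ m ∈ range n, ((1 - (p ^ m * c) ^ 2) / 4) ^ (p ^ (n - m - 1) * (p - 1) / 2) := by
  have hp : p.Prime := Fact.out
  have h2 : 2 ∣ p - 1 := by
    have := hp.eq_two_or_odd; omega
  induction n generalizing c with
  | zero => simp [hh_zero]
  | succ n ih =>
    rw [pow_succ', prod_range_mul_aux]
    have hr : range p = insert 0 ((range p).erase 0) := (insert_erase (by simp [hp.pos])).symm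
    have : ∀ b ∈ range (p ^ n), ∏ a ∈ range p, ((1 - hh p (a + p * b) * c) / 2) =
        ((1 - hh p b * (p * c)) / 2) * ((1 - c ^ 2) / 4) ^ ((p - 1) / 2) := by
      intro b _
      rw [hr, prod_insert (by simp), ← prod_unit p hodd]
      congr 1
      · rw [zero_add, hh_mul]; ring
      · refine prod_congr rfl fun a ha => ?_
        simp only [mem_erase, mem_range] at ha
        rw [hh_unit p _ (not_dvd_of p a b ha.2 ha.1)]
        simp
    rw [prod_congr rfl this, prod_mul_distrib, ih, prod_const, card_range, prod_range_succ', mul_assoc]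
    congr 1
    congr 1
    · refine prod_congr rfl fun m _ => ?_
      rw [show n + 1 - (m + 1) - 1 = n - m - 1 by omega]
      congr 2
      ring
    · rw [← pow_mul, Nat.mul_comm ((p-1)/2), Nat.mul_div_assoc _ h2]
      simp

theorem dh_eq (i : ℕ) : (dh p i : ℂ) = (1 - ff p i + if i = 0 then 1 else 0) / 2 := by
  have hp : p.Prime := Fact.out
  by_cases h0 : i = 0
  · simp [dh, ff, h0]
  · have hne : ((i / p ^ padicValNat p i : ℕ) : ZMod p) ≠ 0 := by
      rw [Ne, ZMod.natCast_eq_zero_iff]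
      have := Nat.not_dvd_ordCompl hp h0
      rwa [Nat.factorization_def _ hp] at this
    simp only [dh, ff, h0, false_or, if_false]
    by_cases hsq : IsSquare ((i / p ^ padicValNat p i : ℕ) : ZMod p)
    · have h1 := (quadraticChar_one_iff_isSquare hne).2 hsq
      have : qch p ((i / p ^ padicValNat p i : ℕ) : ZMod p) = 1 := by
        rw [qch, MulChar.ringHomComp_apply, h1]; simp
      rw [this, if_neg (not_not.2 hsq)]; simp
    · have h1 := quadraticChar_neg_one_iff_not_isSquare.2 hsq
      have : qch p ((i / p ^ padicValNat p i : ℕ) : ZMod p) = -1 := by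
        rw [qch, MulChar.ringHomComp_apply, h1]; simp
      rw [this, if_pos hsq]; norm_num

theorem eig (hodd : p ≠ 2) (n k : ℕ) (hk : k < p ^ n) :
    ∑ i ∈ range (p ^ n), (dh p i : ℂ) * zt p n ^ (i * k) =
    (1 - hh p k * GG p) / 2 * if k = 0 then ((p : ℂ) ^ n + 1) else 1 := by
  have hp : p.Prime := Fact.out
  have e : ∀ i, (dh p i : ℂ) * zt p n ^ (i * k) = (zt p n ^ (i * k) - ff p i * zt p n ^ (i * k)
      + if i = 0 then 1 else 0) / 2 := by
    intro i
    rw [dh_eq]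
    by_cases h : i = 0
    · simp [h]
    · simp only [h, if_false]; ring
  simp only [e]
  rw [← sum_div, sum_add_distrib, sum_sub_distrib, geom_zt, sum_ite_eq',
    if_pos (mem_range.2 (pow_pos hp.pos n))]
  have := FF_lt p hodd n k hk
  rw [FF] at this
  rw [this]
  by_cases h0 : k = 0
  · simp [h0, hh_zero]; ring
  · rw [if_neg, if_neg h0]
    · ring
    · exact Nat.not_dvd_of_pos_of_lt (Nat.pos_of_ne_zero h0) hk

theorem det_circ (n : ℕ) (A : Matrix (Fin (p ^ n)) (Fin (p ^ n)) ℤ)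
    (hA : ∀ i j : Fin (p ^ n), A i j = (dh p ((i - j : Fin (p ^ n)).val) : ℤ)) :
    (A.det : ℂ) = ∏ k ∈ range (p ^ n), ∑ i ∈ range (p ^ n), (dh p i : ℂ) * zt p n ^ (i * k) := by
  have hp : p.Prime := Fact.out
  have : NeZero (p ^ n) := ⟨pow_ne_zero _ hp.ne_zero⟩
  have hz := zt_prim p n
  have hz0 : zt p n ≠ 0 := hz.ne_zero (NeZero.ne _)
  set lam : ℕ → ℂ := fun k => ∑ i ∈ range (p ^ n), (dh p i : ℂ) * zt p n ^ (i * k) with hlam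
  let W : Matrix (Fin (p ^ n)) (Fin (p ^ n)) ℂ :=
    Matrix.vandermonde (fun i : Fin (p ^ n) => (zt p n)⁻¹ ^ (i : ℕ))
  have hW : W.det ≠ 0 := by
    rw [Matrix.det_vandermonde_ne_zero_iff]
    intro a b hab
    exact Fin.ext (hz.inv.pow_inj a.2 b.2 hab)
  let B : Matrix (Fin (p ^ n)) (Fin (p ^ n)) ℂ := A.map (Int.castRingHom ℂ)
  have hB : B.det = (A.det : ℂ) := by
    have := (Int.castRingHom ℂ).map_det A
    simpa [B] using this.symm
  have hBW : B * W = W * Matrix.diagonal (fun k : Fin (p ^ n) => lam k) := by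
    ext i k
    rw [Matrix.mul_diagonal, Matrix.mul_apply, ← Equiv.sum_comp (Equiv.subLeft i)]
    simp only [hlam]
    rw [← Fin.sum_univ_eq_sum_range (fun l => (dh p l : ℂ) * zt p n ^ (l * (k : ℕ))), mul_sum]
    refine sum_congr rfl fun l _ => ?_
    simp only [Equiv.subLeft_apply, B, W, Matrix.map_apply, Matrix.vandermonde_apply, hA,
      sub_sub_cancel]
    have hmod : (zt p n)⁻¹ ^ ((i - l : Fin (p ^ n)) : ℕ) = (zt p n)⁻¹ ^ (i : ℕ) * zt p n ^ (l : ℕ) := by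
      have h1 : (zt p n)⁻¹ ^ (p ^ n) = 1 := hz.inv.pow_eq_one
      rw [Fin.val_sub, ← pow_eq_pow_mod _ h1, pow_add, pow_sub₀ _ (inv_ne_zero hz0) l.2.le, h1]
      simp [mul_comm]
    rw [hmod, mul_pow, ← pow_mul, ← pow_mul]
    simp
    ring
  have := congrArg Matrix.det hBW
  rw [Matrix.det_mul, Matrix.det_mul, Matrix.det_diagonal, mul_comm] at this
  rw [← hB, mul_left_cancel₀ hW this, Fin.prod_univ_eq_prod_range]

theorem det_final (hodd : p ≠ 2) (n : ℕ) (A : Matrix (Fin (p ^ n)) (Fin (p ^ n)) ℤ)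
    (hA : ∀ i j : Fin (p ^ n), A i j = (dh p ((i - j : Fin (p ^ n)).val) : ℤ)) :
    (A.det : ℂ) = (p ^ n + 1) / 2 *
      ∏ m ∈ range n, ((1 - ((ZMod.χ₄ p : ℤ) : ℂ) * p ^ (2 * m + 1)) / 4) ^ (p ^ (n - m - 1) * (p - 1) / 2) := by
  have hp : p.Prime := Fact.out
  rw [det_circ p n A hA, prod_congr rfl (fun k hk => eig p hodd n k (mem_range.1 hk)), prod_mul_distrib,
    prod_hh p hodd, prod_ite_eq' , if_pos (by simp [hp.pos])]
  rw [mul_right_comm]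
  congr 1
  · ring
  · refine prod_congr rfl fun m _ => ?_
    rw [mul_pow, gg_sq p hodd]
    congr 1
    ring
end

theorem stmt_16 (p n : ℕ) (hp : p.Prime) (hodd : Odd p) (hn : 0 < n)
    (A : Matrix (Fin (p ^ n)) (Fin (p ^ n)) ℤ)
    (hA : ∀ i j : Fin (p ^ n), A i j = (dh p ((i - j : Fin (p ^ n)).val) : ℤ)) :
    (p % 4 = 1 → A.det = (((p ^ n + 1) / 2 : ℕ) : ℤ) *
      ∏ m ∈ Finset.range n,
        ((((p ^ (2 * m + 1) - 1) / 4 : ℕ) : ℤ)) ^ (p ^ (n - m - 1) * (p - 1) / 2)) ∧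
    (p % 4 = 3 → A.det = (((p ^ n + 1) / 2 : ℕ) : ℤ) *
      ∏ m ∈ Finset.range n,
        ((((p ^ (2 * m + 1) + 1) / 4 : ℕ) : ℤ)) ^ (p ^ (n - m - 1) * (p - 1) / 2)) := by
  have : Fact p.Prime := ⟨hp⟩
  have h2 : p ≠ 2 := by rintro rfl; exact absurd hodd (by decide)
  have key := det_final p h2 n A hA
  have hN : (((p ^ n + 1) / 2 : ℕ) : ℂ) = (p ^ n + 1) / 2 := by
    rw [Nat.cast_div (by have := (hodd.pow (n := n)).add_one; exact this.two_dvd) (by norm_num)]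
    push_cast; rfl
  constructor
  · intro h
    rw [ZMod.χ₄_nat_one_mod_four h] at key
    have : (A.det : ℂ) = ((_ : ℤ) : ℂ) := key.trans (b := _) (c := (((((p ^ n + 1) / 2 : ℕ) : ℤ) *
      ∏ m ∈ Finset.range n,
        ((((p ^ (2 * m + 1) - 1) / 4 : ℕ) : ℤ)) ^ (p ^ (n - m - 1) * (p - 1) / 2) : ℤ) : ℂ)) ?_
    · exact_mod_cast this
    rw [Int.cast_mul, Int.cast_natCast, hN, Int.cast_prod]
    congr 1
    refine prod_congr rfl fun m _ => ?_
    rw [Int.cast_pow, Int.cast_natCast]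
    have hm : p ^ (2 * m + 1) % 4 = 1 := by rw [Nat.pow_mod, h]; simp
    have hd : 4 ∣ p ^ (2 * m + 1) - 1 := by omega
    rw [Nat.cast_div hd (by norm_num), Nat.cast_sub (by omega)]
    have he : Even (p ^ (n - m - 1) * (p - 1) / 2) := by
      rw [Nat.mul_div_assoc _ (by omega)]
      exact (Nat.even_iff.2 (by omega)).mul_left _
    rw [← he.neg_pow]
    congr 1
    push_cast
    ring
  · intro h
    rw [ZMod.χ₄_nat_three_mod_four h] at key
    have : (A.det : ℂ) = ((_ : ℤ) : ℂ) := key.trans (b := _) (c := (((((p ^ n + 1) / 2 : ℕ) : ℤ) *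
      ∏ m ∈ Finset.range n,
        ((((p ^ (2 * m + 1) + 1) / 4 : ℕ) : ℤ)) ^ (p ^ (n - m - 1) * (p - 1) / 2) : ℤ) : ℂ)) ?_
    · exact_mod_cast this
    rw [Int.cast_mul, Int.cast_natCast, hN, Int.cast_prod]
    congr 1
    refine prod_congr rfl fun m _ => ?_
    rw [Int.cast_pow, Int.cast_natCast]
    have hm : p ^ (2 * m + 1) % 4 = 3 := by
      rw [Nat.pow_mod, h, pow_succ, pow_mul, Nat.mul_mod, Nat.pow_mod]; simp
    have hd : 4 ∣ p ^ (2 * m + 1) + 1 := by omega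
    rw [Nat.cast_div hd (by norm_num)]
    congr 1
    push_cast
    ring
end

section
/- Let p be an odd prime, n a positive integer, and let r be a prime such that the multiplicative order of 2 modulo r equals p^n. Then r does not divide p^n + 1, and for every integer m with 0 ≤ m ≤ n−1, r does not divide p^{2m+1} − 1. -/
theorem stmt_17 (p n : ℕ) (hp : p.Prime) (hodd : Odd p) (hn : 0 < n)
    (r : ℕ) (hr : r.Prime) (hord : orderOf (2 : ZMod r) = p ^ n) :
    ¬ r ∣ p ^ n + 1 ∧ ∀ m : ℕ, m ≤ n - 1 → ¬ r ∣ p ^ (2 * m + 1) - 1 := by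
  have : Fact r.Prime := ⟨hr⟩
  have hq : 0 < p ^ n := pow_pos hp.pos n
  have h2 : (2 : ZMod r) ≠ 0 := by
    intro h
    rw [h, orderOf_zero] at hord
    omega
  have hr2 : r ≠ 2 := by
    rintro rfl
    exact h2 (ZMod.natCast_self 2)
  have hdvd : p ^ n ∣ r - 1 := by
    rw [← hord]
    exact orderOf_dvd_of_pow_eq_one (ZMod.pow_card_sub_one_eq_one h2)
  have hev : 2 ∣ r - 1 := by
    obtain ⟨k, hk⟩ := hr.odd_of_ne_two hr2
    exact ⟨k, by omega⟩
  have hcop : Nat.Coprime 2 (p ^ n) := Nat.coprime_two_left.mpr hodd.pow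
  obtain ⟨k, hk⟩ := hcop.mul_dvd_of_dvd_of_dvd hev hdvd
  have hr1 := hr.two_le
  have hk0 : 0 < k := by
    rcases Nat.eq_zero_or_pos k with h | h
    · subst h; omega
    · exact h
  have hrk : r = 2 * p ^ n * k + 1 := by omega
  have hbig : 2 * p ^ n + 1 ≤ r := by
    rw [hrk]; nlinarith
  refine ⟨fun h => ?_, fun m hm h => ?_⟩
  · have := Nat.le_of_dvd (by omega) h
    omega
  · have hP : 1 < p ^ (2 * m + 1) := Nat.one_lt_pow (by omega) hp.one_lt
    by_cases hmn : 2 * m + 1 < n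
    · have h1 := Nat.le_of_dvd (by omega) h
      have h2 : p ^ (2 * m + 1) ≤ p ^ n := Nat.pow_le_pow_right hp.pos hmn.le
      omega
    · obtain ⟨s, hs⟩ := h
      have hPs : p ^ (2 * m + 1) = p ^ n * (2 * k * s) + (s + 1) := by
        have : p ^ (2 * m + 1) = r * s + 1 := by omega
        rw [this, hrk]; ring
      have hd : p ^ n ∣ p ^ (2 * m + 1) := pow_dvd_pow p (by omega)
      rw [hPs] at hd
      have hd1 : p ^ n ∣ s + 1 := (Nat.dvd_add_right (dvd_mul_right _ _)).mp hd
      have hle := Nat.le_of_dvd (by omega) hd1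
      have hlt : p ^ (2 * m + 1) < p ^ (2 * n) := Nat.pow_lt_pow_right hp.one_lt (by omega)
      have hsq : p ^ (2 * n) = p ^ n * p ^ n := by rw [two_mul, pow_add]
      have hrs : p ^ (2 * m + 1) = r * s + 1 := by omega
      nlinarith [Nat.mul_le_mul_right s hbig]
end
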